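/- arXiv:1107.5328 — 8 statements merged into one kernel-verified Lean document; each statement's English description precedes it below -/
import Mathlib

section
/- Let m ∈ {2,3,4} and 0 ≤ λ < 1, and let a be an admissible potential. There exists ε₀ > 0 such that for every 0 < ε < ε₀ the soliton ODE system C'(t) = ε f₁(C(t),P(t)), P'(t) = C(t) − λ, with C(−T_ε) = 1 and P(−T_ε) = −(1−λ)T_ε, has a unique C¹ solution (C,P) defined on all of [−T_ε, +∞); moreover C is positive, bounded and monotone on [−T_ε, +∞), and lim_{t→+∞} C(t) exists and is strictly positive. -/
open Real Filter Set

/-- `λ₀ = (5-m)/(m+3)`. -/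
noncomputable def lam0 (m : ℕ) : ℝ := ((5 : ℝ) - m) / ((m : ℝ) + 3)

/-- The interaction time `T_ε = ε^{-1-1/100}/(1-λ)`. -/
noncomputable def Teps (lam eps : ℝ) : ℝ := eps ^ (-(1 : ℝ) - 1 / 100) / (1 - lam)

/-- `f₁(C,P) = (4/(m+3)) C (C - λ/λ₀) a'(εP)/a(εP)`. -/
noncomputable def f1 (m : ℕ) (lam : ℝ) (a : ℝ → ℝ) (eps C P : ℝ) : ℝ :=
  (4 / ((m : ℝ) + 3)) * C * (C - lam / lam0 m) * deriv a (eps * P) / a (eps * P)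

/-- An admissible potential: `a` is `C³`, strictly increasing, with `1 < a < 2`,
exponential convergence to the limits `1` and `2`, and exponentially decaying
derivatives up to third order. -/
def Admissible (a : ℝ → ℝ) : Prop :=
  ContDiff ℝ 3 a ∧
    ∃ K γ : ℝ, 0 < K ∧ 0 < γ ∧
      (∀ r : ℝ, 1 < a r ∧ a r < 2 ∧ 0 < deriv a r) ∧
      (∀ r : ℝ, r ≤ 0 → a r - 1 ≤ K * Real.exp (γ * r)) ∧
      (∀ r : ℝ, 0 ≤ r → 2 - a r ≤ K * Real.exp (-γ * r)) ∧
      (∀ k : ℕ, 1 ≤ k → k ≤ 3 → ∀ r : ℝ, |iteratedDeriv k a r| ≤ K * Real.exp (-γ * |r|))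

/-- `(C,P)` is a `C¹` solution on `[-T_ε, +∞)` of the soliton ODE system
`C' = ε f₁(C,P)`, `P' = C - λ`, with `C(-T_ε) = 1`, `P(-T_ε) = -(1-λ)T_ε`. -/
def IsSolODE (m : ℕ) (lam : ℝ) (a : ℝ → ℝ) (eps : ℝ) (C P : ℝ → ℝ) : Prop :=
  (∀ t ∈ Set.Ici (-Teps lam eps),
      HasDerivWithinAt C (eps * f1 m lam a eps (C t) (P t)) (Set.Ici (-Teps lam eps)) t ∧
      HasDerivWithinAt P (C t - lam) (Set.Ici (-Teps lam eps)) t) ∧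
    C (-Teps lam eps) = 1 ∧ P (-Teps lam eps) = -((1 - lam) * Teps lam eps)

/-- A bounded, globally Lipschitz autonomous vector field has forward-global solutions. -/
theorem exists_hasDerivWithinAt_Ici_of_lipschitzWith_of_bounded
    {E : Type*} [NormedAddCommGroup E] [NormedSpace ℝ E] [CompleteSpace E]
    {v : E → E} {K L : NNReal} (hv : LipschitzWith K v) (hL : ∀ x, ‖v x‖ ≤ L)
    (t₀ : ℝ) (x₀ : E) :
    ∃ f : ℝ → E, f t₀ = x₀ ∧ ∀ t ∈ Ici t₀, HasDerivWithinAt f (v (f t)) (Ici t₀) t := by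
  have hloc (n : ℕ) : ∃ f : ℝ → E, f t₀ = x₀ ∧
      ∀ t ∈ Icc t₀ (t₀ + n), HasDerivWithinAt f (v (f t)) (Icc t₀ (t₀ + n)) t := by
    have ht : t₀ ∈ Icc t₀ (t₀ + n) := ⟨le_rfl, by simp⟩
    refine IsPicardLindelof.exists_eq_forall_mem_Icc_hasDerivWithinAt₀
      (f := fun _ ↦ v) (t₀ := ⟨t₀, ht⟩) (a := L * n) (L := L) (K := K) ?_
    exact ⟨fun _ _ ↦ hv.lipschitzOnWith, fun _ _ ↦ continuousOn_const, fun _ _ x _ ↦ hL x,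
      by simp⟩
  choose α hα₀ hα using hloc
  have hright (n : ℕ) {b t : ℝ} (hb : b ≤ t₀ + n) (ht : t ∈ Ico t₀ b) :
      HasDerivWithinAt (α n) (v (α n t)) (Ici t) t :=
    (hα n t ⟨ht.1, ht.2.le.trans hb⟩).mono_of_mem_nhdsWithin
      (mem_of_superset (Icc_mem_nhdsGE (ht.2.trans_le hb)) (Icc_subset_Icc_left ht.1))
  have hagree {n k : ℕ} (hnk : n ≤ k) : EqOn (α n) (α k) (Icc t₀ (t₀ + n)) := by
    have hb : t₀ + n ≤ t₀ + k := by gcongr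
    refine ODE_solution_unique_of_mem_Icc_right (v := fun _ ↦ v) (s := fun _ ↦ univ)
      (fun _ _ ↦ hv.lipschitzOnWith) (fun t ht ↦ (hα n t ht).continuousWithinAt)
      (fun t ht ↦ hright n le_rfl ht) (fun _ _ ↦ mem_univ _)
      (fun t ht ↦ ((hα k t (Icc_subset_Icc_right hb ht)).mono
        (Icc_subset_Icc_right hb)).continuousWithinAt)
      (fun t ht ↦ hright k hb ht) (fun _ _ ↦ mem_univ _) ((hα₀ n).trans (hα₀ k).symm)
  have hglue {n : ℕ} {s : ℝ} (hs : s ∈ Icc t₀ (t₀ + n)) : α (⌈s - t₀⌉₊) s = α n s := by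
    refine hagree (Nat.ceil_le.2 (by linarith [hs.2])) ⟨hs.1, ?_⟩
    linarith [Nat.le_ceil (s - t₀)]
  refine ⟨fun t ↦ α (⌈t - t₀⌉₊) t, by simp [hα₀], fun t ht ↦ ?_⟩
  obtain ⟨n, hn⟩ := exists_nat_gt (t - t₀)
  have htn : t < t₀ + n := by linarith
  have hmem : t ∈ Icc t₀ (t₀ + n) := ⟨ht, htn.le⟩
  have h := (hα n t hmem).congr (f₁ := fun t ↦ α (⌈t - t₀⌉₊) t) (fun s hs ↦ hglue hs) (hglue hmem)
  rw [← hglue hmem] at h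
  refine h.mono_of_mem_nhdsWithin ?_
  filter_upwards [self_mem_nhdsWithin, mem_nhdsWithin_of_mem_nhds (Iio_mem_nhds htn)] with s hs hs'
  exact ⟨hs, hs'.le⟩

/-- Two solutions on a half-line agree if the field is Lipschitz on each slab `|x| ≤ R`. -/
theorem eq_of_hasDerivWithinAt_Ici_of_lipschitzOnWith {v : ℝ × ℝ → ℝ × ℝ} {t₀ : ℝ}
    (hv : ∀ R : ℝ, ∃ K : NNReal, LipschitzOnWith K v {z | |z.1| ≤ R}) {f g : ℝ → ℝ × ℝ}
    (hf : ∀ t ∈ Ici t₀, HasDerivWithinAt f (v (f t)) (Ici t₀) t)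
    (hg : ∀ t ∈ Ici t₀, HasDerivWithinAt g (v (g t)) (Ici t₀) t) (h₀ : f t₀ = g t₀) :
    EqOn f g (Ici t₀) := by
  intro t ht
  have hcont {f : ℝ → ℝ × ℝ} (hf : ∀ t ∈ Ici t₀, HasDerivWithinAt f (v (f t)) (Ici t₀) t) :
      ContinuousOn f (Icc t₀ t) :=
    fun s hs ↦ ((hf s hs.1).mono Icc_subset_Ici_self).continuousWithinAt
  obtain ⟨R₁, hR₁⟩ := isCompact_Icc.exists_bound_of_continuousOn (hcont hf).fst
  obtain ⟨R₂, hR₂⟩ := isCompact_Icc.exists_bound_of_continuousOn (hcont hg).fst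
  obtain ⟨K, hK⟩ := hv (max R₁ R₂)
  exact ODE_solution_unique_of_mem_Icc_right (v := fun _ ↦ v)
    (s := fun _ ↦ {z | |z.1| ≤ max R₁ R₂}) (fun _ _ ↦ hK) (hcont hf)
    (fun s hs ↦ (hf s hs.1).mono (Ici_subset_Ici.2 hs.1))
    (fun s hs ↦ (hR₁ s (Ico_subset_Icc_self hs)).trans (le_max_left _ _)) (hcont hg)
    (fun s hs ↦ (hg s hs.1).mono (Ici_subset_Ici.2 hs.1))
    (fun s hs ↦ (hR₂ s (Ico_subset_Icc_self hs)).trans (le_max_right _ _)) h₀ ⟨ht, le_rfl⟩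

/-- A field `(x, p) ↦ (A x * q (e * p), W x)` is Lipschitz wherever `A` and `W` are, when `A` and
`q` are bounded and `q` is Lipschitz. -/
theorem exists_lipschitzOnWith_prod_field {A W q : ℝ → ℝ} {S : Set ℝ} {B L M N : ℝ} (e : ℝ)
    (hB : ∀ x ∈ S, |A x| ≤ B) (hA : ∀ x ∈ S, ∀ y ∈ S, |A x - A y| ≤ L * |x - y|)
    (hW : ∀ x ∈ S, ∀ y ∈ S, |W x - W y| ≤ N * |x - y|)
    (hM : ∀ r, |q r| ≤ M) (hq : ∀ r s, |q r - q s| ≤ M * |r - s|)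
    (hL : 0 ≤ L) (hN : 0 ≤ N) :
    ∃ K : NNReal, LipschitzOnWith K (fun z : ℝ × ℝ ↦ (A z.1 * q (e * z.2), W z.1))
      {z | z.1 ∈ S} := by
  have hM₀ : 0 ≤ M := (abs_nonneg _).trans (hM 0)
  refine ⟨(L * M + |B| * (M * |e|) + N).toNNReal, LipschitzOnWith.of_dist_le_mul ?_⟩
  rintro ⟨x, p⟩ hx ⟨y, r⟩ hy
  have hx : x ∈ S := hx
  have hy : y ∈ S := hy
  rw [Real.coe_toNNReal _ (by positivity)]
  set D := dist (x, p) (y, r)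
  have h1 : |x - y| ≤ D := le_max_left _ _
  have h2 : |p - r| ≤ D := le_max_right _ _
  have hD₀ : 0 ≤ D := dist_nonneg
  have hAq : |A x * q (e * p) - A y * q (e * r)| ≤ (L * M + |B| * (M * |e|)) * D := by
    have h3 : |A x - A y| * |q (e * p)| ≤ L * D * M :=
      mul_le_mul ((hA x hx y hy).trans (by gcongr)) (hM _) (abs_nonneg _) (by positivity)
    have h4 : |A y| * |q (e * p) - q (e * r)| ≤ |B| * (M * (|e| * D)) := by
      refine mul_le_mul ((hB y hy).trans (le_abs_self B)) ((hq _ _).trans ?_) (abs_nonneg _)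
        (abs_nonneg _)
      rw [← mul_sub, abs_mul]
      gcongr
    calc _ = |(A x - A y) * q (e * p) + A y * (q (e * p) - q (e * r))| := by ring_nf
      _ ≤ |A x - A y| * |q (e * p)| + |A y| * |q (e * p) - q (e * r)| := by
        rw [← abs_mul, ← abs_mul]; exact abs_add_le _ _
      _ ≤ _ := by linarith
  refine max_le (hAq.trans ?_) ((hW x hx y hy).trans ?_)
  · exact mul_le_mul_of_nonneg_right (le_add_of_nonneg_right hN) hD₀
  · calc N * |x - y| ≤ N * D := by gcongr
      _ ≤ _ := by
        gcongr
        have : 0 ≤ L * M + |B| * (M * |e|) := by positivity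
        linarith

/-- The logarithmic derivative of an admissible potential is bounded and Lipschitz. -/
theorem Admissible.exists_logDeriv_bound {a : ℝ → ℝ} (ha : Admissible a) :
    ∃ M : ℝ, (∀ r, |deriv a r / a r| ≤ M) ∧
      ∀ r s, |deriv a r / a r - deriv a s / a s| ≤ M * |r - s| := by
  obtain ⟨hC, K, γ, hK, hγ, hb, -, -, hd⟩ := ha
  have hexp (r : ℝ) : K * Real.exp (-γ * |r|) ≤ K :=
    mul_le_of_le_one_right hK.le (Real.exp_le_one_iff.2 (by nlinarith [abs_nonneg r]))
  have h1 (r : ℝ) : |deriv a r| ≤ K := by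
    simpa using (hd 1 le_rfl (by norm_num) r).trans (hexp r)
  have h2 (r : ℝ) : |deriv (deriv a) r| ≤ K := by
    simpa [iteratedDeriv_succ] using (hd 2 (by norm_num) (by norm_num) r).trans (hexp r)
  have hda (r : ℝ) : HasDerivAt a (deriv a r) r := (hC.differentiable (by norm_num) r).hasDerivAt
  have hC' : ContDiff ℝ 2 (deriv a) := by
    have h : ContDiff ℝ (2 + 1) a := by convert hC; norm_num
    exact (contDiff_succ_iff_deriv.1 h).2.2
  have hdda (r : ℝ) : HasDerivAt (deriv a) (deriv (deriv a) r) r :=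
    (hC'.differentiable (by norm_num) r).hasDerivAt
  have hpos (r : ℝ) : 0 < a r := one_pos.trans (hb r).1
  refine ⟨K + K ^ 2, fun r ↦ ?_, fun r s ↦ ?_⟩
  · rw [abs_div, abs_of_pos (hpos r), div_le_iff₀ (hpos r)]
    nlinarith [h1 r, (hb r).1, sq_nonneg K]
  · refine Convex.norm_image_sub_le_of_norm_hasDerivWithin_le
      (fun x _ ↦ ((hdda x).div (hda x) (hpos x).ne').hasDerivWithinAt) (fun x _ ↦ ?_)
      convex_univ (mem_univ s) (mem_univ r)
    have hx := (hb x).1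
    rw [Real.norm_eq_abs, abs_div, abs_of_pos (by positivity : 0 < a x ^ 2),
      div_le_iff₀ (by positivity)]
    have h3 : |deriv (deriv a) x * a x| ≤ K * a x := by
      rw [abs_mul, abs_of_pos (hpos x)]
      exact mul_le_mul_of_nonneg_right (h2 x) (hpos x).le
    have h4 : |deriv a x * deriv a x| ≤ K * K := by
      rw [abs_mul]
      exact mul_le_mul (h1 x) (h1 x) (abs_nonneg _) hK.le
    refine (abs_sub _ _).trans ((add_le_add h3 h4).trans ?_)
    nlinarith [mul_pos hK (hpos x), mul_pos hK hK, mul_pos (mul_pos hK hK) (hpos x)]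

theorem monotoneOn_Ici_of_hasDerivWithinAt_nonneg {f f' : ℝ → ℝ} {t₀ : ℝ}
    (hf : ∀ t ∈ Ici t₀, HasDerivWithinAt f (f' t) (Ici t₀) t) (hf' : ∀ t ∈ Ici t₀, 0 ≤ f' t) :
    MonotoneOn f (Ici t₀) :=
  monotoneOn_of_hasDerivWithinAt_nonneg (convex_Ici t₀)
    (fun t ht ↦ (hf t ht).continuousWithinAt)
    (fun t ht ↦ (hf t (interior_subset ht)).mono interior_subset)
    (fun t ht ↦ hf' t (interior_subset ht))

theorem antitoneOn_Ici_of_hasDerivWithinAt_nonpos {f f' : ℝ → ℝ} {t₀ : ℝ}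
    (hf : ∀ t ∈ Ici t₀, HasDerivWithinAt f (f' t) (Ici t₀) t) (hf' : ∀ t ∈ Ici t₀, f' t ≤ 0) :
    AntitoneOn f (Ici t₀) :=
  antitoneOn_of_hasDerivWithinAt_nonpos (convex_Ici t₀)
    (fun t ht ↦ (hf t ht).continuousWithinAt)
    (fun t ht ↦ (hf t (interior_subset ht)).mono interior_subset)
    (fun t ht ↦ hf' t (interior_subset ht))

/-- A function that is monotone or antitone on a half-line, with values in `[c, d]`, converges to
a limit which is at least `c`. -/
theorem exists_tendsto_atTop_of_monotoneOn_or_antitoneOn_Ici {f : ℝ → ℝ} {t₀ c d : ℝ}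
    (hf : MonotoneOn f (Ici t₀) ∨ AntitoneOn f (Ici t₀))
    (hb : ∀ t ∈ Ici t₀, c ≤ f t ∧ f t ≤ d) : ∃ l, c ≤ l ∧ Tendsto f atTop (nhds l) := by
  have hmem (t : ℝ) : max t₀ t ∈ Ici t₀ := mem_Ici.2 (le_max_left _ _)
  have heq : (fun t ↦ f (max t₀ t)) =ᶠ[atTop] f := by
    filter_upwards [eventually_ge_atTop t₀] with t ht
    rw [max_eq_right ht]
  obtain ⟨l, hl⟩ : ∃ l, Tendsto (fun t ↦ f (max t₀ t)) atTop (nhds l) := by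
    rcases hf with hf | hf
    · exact ⟨_, tendsto_atTop_ciSup
        (fun s t hst ↦ hf (hmem s) (hmem t) (max_le_max le_rfl hst))
        ⟨d, forall_mem_range.2 fun t ↦ (hb _ (hmem t)).2⟩⟩
    · exact ⟨_, tendsto_atTop_ciInf
        (fun s t hst ↦ hf (hmem s) (hmem t) (max_le_max le_rfl hst))
        ⟨c, forall_mem_range.2 fun t ↦ (hb _ (hmem t)).1⟩⟩
  exact ⟨l, ge_of_tendsto' hl fun t ↦ (hb _ (hmem t)).1, hl.congr' heq⟩

/-- The soliton system in the variable `y = log C`, with `y` truncated by `g`, has forward-global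
solutions. -/
theorem Admissible.exists_truncated_log_solution {a : ℝ → ℝ} (ha : Admissible a)
    (k mu lam eps t₀ p₀ : ℝ) {g : ℝ → ℝ} (hg : LipschitzWith 1 g) (hg₂ : ∀ x, g x ≤ log 2) :
    ∃ y P : ℝ → ℝ, y t₀ = 0 ∧ P t₀ = p₀ ∧ ∀ t ∈ Ici t₀,
      HasDerivWithinAt y (eps * k * (exp (g (y t)) - mu) *
        (deriv a (eps * P t) / a (eps * P t))) (Ici t₀) t ∧
      HasDerivWithinAt P (exp (g (y t)) - lam) (Ici t₀) t := by
  obtain ⟨M, hM, hq⟩ := ha.exists_logDeriv_bound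
  have hM₀ : 0 ≤ M := (abs_nonneg _).trans (hM 0)
  have hexp_le (x : ℝ) (hx : x ≤ log 2) : exp x ≤ 2 := by
    simpa [exp_log] using exp_le_exp.2 hx
  have hE (x : ℝ) : |exp (g x)| ≤ 2 := by
    rw [abs_of_pos (exp_pos _)]
    exact hexp_le _ (hg₂ x)
  have hE' (x y : ℝ) : |exp (g x) - exp (g y)| ≤ 2 * |x - y| := by
    have h := Convex.norm_image_sub_le_of_norm_hasDerivWithin_le (f := exp) (f' := exp) (C := 2)
      (fun x _ ↦ (Real.hasDerivAt_exp x).hasDerivWithinAt)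
      (fun x hx ↦ by rw [norm_of_nonneg (exp_pos x).le]; exact hexp_le x hx)
      (convex_Iic (log 2)) (hg₂ y) (hg₂ x)
    have h' := hg.dist_le_mul x y
    simp only [dist_eq, NNReal.coe_one, one_mul] at h'
    exact h.trans (by rw [norm_eq_abs]; gcongr)
  have hA (x : ℝ) : |eps * k * (exp (g x) - mu)| ≤ |eps * k| * (2 + |mu|) := by
    rw [abs_mul]
    gcongr
    exact (abs_sub _ _).trans (by gcongr; exact hE x)
  obtain ⟨K, hK⟩ := exists_lipschitzOnWith_prod_field (S := univ)
    (A := fun x ↦ eps * k * (exp (g x) - mu)) (W := fun x ↦ exp (g x) - lam)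
    (q := fun r ↦ deriv a r / a r) (L := |eps * k| * 2) (N := 2) eps (fun x _ ↦ hA x)
    (fun x _ y _ ↦ by
      rw [← mul_sub, sub_sub_sub_cancel_right, abs_mul, mul_assoc]
      gcongr
      exact hE' x y)
    (fun x _ y _ ↦ by rw [sub_sub_sub_cancel_right]; exact hE' x y) hM hq (by positivity)
    zero_le_two
  have hL₀ : 0 ≤ |eps * k| * (2 + |mu|) * M + (2 + |lam|) := by positivity
  obtain ⟨f, hf₀, hf⟩ := exists_hasDerivWithinAt_Ici_of_lipschitzWith_of_bounded
    (L := ⟨_, hL₀⟩) (lipschitzOnWith_univ.1 hK) (fun z ↦ by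
      have h1 := mul_le_mul (hA z.1) (hM (eps * z.2)) (abs_nonneg _) (by positivity)
      have h2 : |exp (g z.1) - lam| ≤ 2 + |lam| :=
        (abs_sub _ _).trans (by gcongr; exact hE z.1)
      rw [← abs_mul] at h1
      exact max_le (h1.trans (le_add_of_nonneg_right (by positivity)))
        (h2.trans (le_add_of_nonneg_left (by positivity)))) t₀ ((0 : ℝ), p₀)
  refine ⟨fun t ↦ (f t).1, fun t ↦ (f t).2, by simp [hf₀], by simp [hf₀], fun t ht ↦ ?_⟩
  exact ⟨(hf t ht).fst, (hf t ht).snd⟩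

theorem Admissible.hasDerivWithinAt_log_comp {a : ℝ → ℝ} (ha : Admissible a) {P : ℝ → ℝ}
    {eps p t : ℝ} {s : Set ℝ} (hP : HasDerivWithinAt P p s t) :
    HasDerivWithinAt (fun t ↦ log (a (eps * P t)))
      (eps * p * (deriv a (eps * P t) / a (eps * P t))) s t := by
  obtain ⟨hC, K, γ, -, -, hb, -⟩ := ha
  have hda := (hC.differentiable (by norm_num) (eps * P t)).hasDerivAt
  have h := (hda.comp_hasDerivWithinAt t (hP.const_mul eps)).log
    (one_pos.trans (hb (eps * P t)).1).ne'
  refine h.congr_deriv ?_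
  dsimp only [Function.comp_def]
  ring

theorem Admissible.log_mem_Ioo {a : ℝ → ℝ} (ha : Admissible a) (r : ℝ) :
    log (a r) ∈ Ioo 0 (log 2) := by
  obtain ⟨-, K, γ, -, -, hb, -⟩ := ha
  exact ⟨log_pos (hb r).1, log_lt_log (one_pos.trans (hb r).1) (hb r).2.1⟩

theorem Admissible.logDeriv_pos {a : ℝ → ℝ} (ha : Admissible a) (r : ℝ) :
    0 < deriv a r / a r := by
  obtain ⟨-, K, γ, -, -, hb, -⟩ := ha
  exact div_pos (hb r).2.2 (one_pos.trans (hb r).1)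

theorem isSolODE_exp {m : ℕ} {lam eps : ℝ} {a y P : ℝ → ℝ} (hy₀ : y (-Teps lam eps) = 0)
    (hP₀ : P (-Teps lam eps) = -((1 - lam) * Teps lam eps))
    (h : ∀ t ∈ Ici (-Teps lam eps),
      HasDerivWithinAt y (eps * (4 / ((m : ℝ) + 3)) * (exp (y t) - lam / lam0 m) *
        (deriv a (eps * P t) / a (eps * P t))) (Ici (-Teps lam eps)) t ∧
      HasDerivWithinAt P (exp (y t) - lam) (Ici (-Teps lam eps)) t) :
    IsSolODE m lam a eps (fun t ↦ exp (y t)) P := by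
  refine ⟨fun t ht ↦ ⟨?_, (h t ht).2⟩, by simp [hy₀], hP₀⟩
  convert (h t ht).1.exp using 1
  rw [f1]
  ring

/-- If `λ/λ₀ < 1`, there is a nondecreasing solution with values in `[1, 2]`. -/
theorem exists_isSolODE_monotoneOn {m : ℕ} {lam eps : ℝ} {a : ℝ → ℝ} (ha : Admissible a)
    (heps : 0 < eps) (hk : 4 / ((m : ℝ) + 3) ≤ 1) (hlam : lam ≤ lam / lam0 m)
    (hmu : lam / lam0 m < 1) :
    ∃ C P : ℝ → ℝ, IsSolODE m lam a eps C P ∧ MonotoneOn C (Ici (-Teps lam eps)) ∧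
      ∀ t ∈ Ici (-Teps lam eps), 1 ≤ C t ∧ C t ≤ 2 := by
  have hg : LipschitzWith 1 fun x : ℝ ↦ max (min x (log 2)) 0 :=
    (LipschitzWith.id.min_const _).max_const _
  have hlog2 : 0 < log 2 := log_pos one_lt_two
  obtain ⟨y, P, hy₀, hP₀, h⟩ := ha.exists_truncated_log_solution (4 / ((m : ℝ) + 3))
    (lam / lam0 m) lam eps (-Teps lam eps) (-((1 - lam) * Teps lam eps)) hg
    (fun x ↦ max_le (min_le_right _ _) hlog2.le)
  set t₀ := -Teps lam eps
  set k : ℝ := 4 / ((m : ℝ) + 3)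
  have hk₀ : 0 < k := by positivity
  have hE (x : ℝ) : 1 ≤ exp (max (min x (log 2)) 0) := one_le_exp (le_max_right _ _)
  have hmono : MonotoneOn y (Ici t₀) :=
    monotoneOn_Ici_of_hasDerivWithinAt_nonneg (fun t ht ↦ (h t ht).1) fun t _ ↦ by
      have := hE (y t)
      exact mul_nonneg (mul_nonneg (by positivity) (by linarith)) (ha.logDeriv_pos _).le
  have hnonneg (t : ℝ) (ht : t ∈ Ici t₀) : 0 ≤ y t := hy₀ ▸ hmono self_mem_Ici ht ht
  have hanti : AntitoneOn (fun t ↦ y t - log (a (eps * P t))) (Ici t₀) :=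
    antitoneOn_Ici_of_hasDerivWithinAt_nonpos
      (fun t ht ↦ (h t ht).1.sub (ha.hasDerivWithinAt_log_comp (h t ht).2)) fun t _ ↦ by
      have h1 := hE (y t)
      have h2 := (ha.logDeriv_pos (eps * P t)).le
      rw [← sub_mul, mul_assoc eps k, ← mul_sub]
      refine mul_nonpos_of_nonpos_of_nonneg (mul_nonpos_of_nonneg_of_nonpos heps.le ?_) h2
      nlinarith
  have hle (t : ℝ) (ht : t ∈ Ici t₀) : y t ≤ log 2 := by
    have := hanti self_mem_Ici ht ht
    simp only [hy₀] at this
    linarith [(ha.log_mem_Ioo (eps * P t)).2, (ha.log_mem_Ioo (eps * P t₀)).1]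
  refine ⟨fun t ↦ exp (y t), P, isSolODE_exp hy₀ hP₀ fun t ht ↦ ?_,
    fun s hs t ht hst ↦ exp_le_exp.2 (hmono hs ht hst),
    fun t ht ↦ ⟨one_le_exp (hnonneg t ht), ?_⟩⟩
  · have := h t ht
    rwa [min_eq_left (hle t ht), max_eq_left (hnonneg t ht)] at this
  · simpa [exp_log] using exp_le_exp.2 (hle t ht)

/-- If `λ/λ₀ > 1`, there is a nonincreasing solution with values in some `[c, 1]`, `c > 0`. The
lower bound comes from the conserved quantity
`λ₀ log C + (1 - λ₀) log (λ/λ₀ - C) - (4/(m+3)) log a(εP)`. -/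
theorem exists_isSolODE_antitoneOn {m : ℕ} {lam eps : ℝ} {a : ℝ → ℝ} (ha : Admissible a)
    (heps : 0 < eps) (hl₀ : 0 < lam0 m) (hl₁ : lam0 m < 1) (hmu : 1 < lam / lam0 m) :
    ∃ C P : ℝ → ℝ, IsSolODE m lam a eps C P ∧ AntitoneOn C (Ici (-Teps lam eps)) ∧
      ∃ c, 0 < c ∧ ∀ t ∈ Ici (-Teps lam eps), c ≤ C t ∧ C t ≤ 1 := by
  have hg : LipschitzWith 1 fun x : ℝ ↦ min x 0 := LipschitzWith.id.min_const _
  obtain ⟨y, P, hy₀, hP₀, h⟩ := ha.exists_truncated_log_solution (4 / ((m : ℝ) + 3))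
    (lam / lam0 m) lam eps (-Teps lam eps) (-((1 - lam) * Teps lam eps)) hg
    (fun x ↦ (min_le_right _ _).trans (log_nonneg one_le_two))
  set t₀ := -Teps lam eps
  set k : ℝ := 4 / ((m : ℝ) + 3)
  set mu := lam / lam0 m with hmu_def
  set l := lam0 m
  have hlam : lam = l * mu := by rw [hmu_def]; field_simp
  have hk₀ : 0 < k := by positivity
  have hE (x : ℝ) : exp (min x 0) ≤ 1 := exp_le_one_iff.2 (min_le_right _ _)
  have hanti : AntitoneOn y (Ici t₀) :=
    antitoneOn_Ici_of_hasDerivWithinAt_nonpos (fun t ht ↦ (h t ht).1) fun t _ ↦ by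
      have := hE (y t)
      exact mul_nonpos_of_nonpos_of_nonneg
        (mul_nonpos_of_nonneg_of_nonpos (by positivity) (by linarith)) (ha.logDeriv_pos _).le
  have hle (t : ℝ) (ht : t ∈ Ici t₀) : y t ≤ 0 := hy₀ ▸ hanti self_mem_Ici ht ht
  replace h (t : ℝ) (ht : t ∈ Ici t₀) := min_eq_left (hle t ht) ▸ h t ht
  have hexp (t : ℝ) (ht : t ∈ Ici t₀) : exp (y t) ≤ 1 := exp_le_one_iff.2 (hle t ht)
  have hmono : MonotoneOn
      (fun t ↦ l * y t + (1 - l) * log (mu - exp (y t)) - k * log (a (eps * P t))) (Ici t₀) := by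
    refine monotoneOn_Ici_of_hasDerivWithinAt_nonneg (fun t ht ↦
      (((h t ht).1.const_mul l).add ((((h t ht).1.exp.const_sub mu).log
        (by linarith [hexp t ht])).const_mul (1 - l))).sub
        ((ha.hasDerivWithinAt_log_comp (h t ht).2).const_mul k)) fun t ht ↦ le_of_eq ?_
    have hne : mu - exp (y t) ≠ 0 := by linarith [hexp t ht]
    rw [hlam]
    field_simp
    ring
  have hlower (t : ℝ) (ht : t ∈ Ici t₀) :
      ((1 - l) * (log (mu - 1) - log mu) - k * log 2) / l ≤ y t := by
    have h0 := hmono self_mem_Ici ht ht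
    simp only [hy₀, exp_zero, mul_zero, zero_add] at h0
    have h1 : (1 - l) * log (mu - exp (y t)) ≤ (1 - l) * log mu :=
      mul_le_mul_of_nonneg_left (log_le_log (by linarith [hexp t ht])
        (by linarith [exp_pos (y t)])) (by linarith)
    have h2 := mul_pos hk₀ (ha.log_mem_Ioo (eps * P t)).1
    have h3 := mul_lt_mul_of_pos_left (ha.log_mem_Ioo (eps * P t₀)).2 hk₀
    rw [div_le_iff₀ hl₀]
    linarith
  exact ⟨fun t ↦ exp (y t), P, isSolODE_exp hy₀ hP₀ h,
    fun s hs t ht hst ↦ exp_le_exp.2 (hanti hs ht hst), _, exp_pos _,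
    fun t ht ↦ ⟨exp_le_exp.2 (hlower t ht), hexp t ht⟩⟩

theorem isSolODE_const {m : ℕ} {lam eps : ℝ} {a : ℝ → ℝ} (hmu : lam / lam0 m = 1) :
    IsSolODE m lam a eps (fun _ ↦ 1) (fun t ↦ (1 - lam) * t) := by
  refine ⟨fun t _ ↦ ⟨?_, ?_⟩, rfl, by ring⟩
  · simpa [f1, hmu] using hasDerivWithinAt_const t _ (1 : ℝ)
  · simpa using (hasDerivWithinAt_id t _).const_mul (1 - lam)

theorem IsSolODE.unique {m : ℕ} {lam eps : ℝ} {a C P C' P' : ℝ → ℝ} (ha : Admissible a)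
    (h : IsSolODE m lam a eps C P) (h' : IsSolODE m lam a eps C' P') {t : ℝ}
    (ht : t ∈ Ici (-Teps lam eps)) : C' t = C t ∧ P' t = P t := by
  obtain ⟨M, hM, hq⟩ := ha.exists_logDeriv_bound
  set k : ℝ := 4 / ((m : ℝ) + 3)
  set mu := lam / lam0 m
  have hsol {C P : ℝ → ℝ} (h : IsSolODE m lam a eps C P) : ∀ t ∈ Ici (-Teps lam eps),
      HasDerivWithinAt (fun t ↦ (C t, P t)) (eps * k * (C t * (C t - mu)) *
        (deriv a (eps * P t) / a (eps * P t)), C t - lam) (Ici (-Teps lam eps)) t := by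
    intro t ht
    convert (h.1 t ht).1.prodMk (h.1 t ht).2 using 2
    rw [f1]
    ring
  have huniq := eq_of_hasDerivWithinAt_Ici_of_lipschitzOnWith
    (v := fun z ↦ (eps * k * (z.1 * (z.1 - mu)) *
      (deriv a (eps * z.2) / a (eps * z.2)), z.1 - lam)) (fun R ↦ ?_) (hsol h') (hsol h)
    (by rw [h.2.1, h.2.2, h'.2.1, h'.2.2]) ht
  · exact Prod.ext_iff.1 huniq
  · refine exists_lipschitzOnWith_prod_field (S := {x : ℝ | |x| ≤ R})
      (A := fun x ↦ eps * k * (x * (x - mu))) (W := fun x ↦ x - lam)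
      (q := fun r ↦ deriv a r / a r) (B := |eps * k| * (|R| * (|R| + |mu|)))
      (L := |eps * k| * (|R| + |R| + |mu|)) (N := 1) eps ?_ ?_ ?_ hM hq (by positivity)
      zero_le_one
    · intro x hx
      have hx' : |x| ≤ |R| := le_trans hx (le_abs_self R)
      rw [abs_mul, abs_mul x]
      gcongr
      exact (abs_sub _ _).trans (by gcongr)
    · intro x hx y hy
      have hx' : |x| ≤ |R| := le_trans hx (le_abs_self R)
      have hy' : |y| ≤ |R| := le_trans hy (le_abs_self R)
      have hxy : eps * k * (x * (x - mu)) - eps * k * (y * (y - mu)) =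
        eps * k * (x + y - mu) * (x - y) := by ring
      rw [hxy, abs_mul, abs_mul (eps * k)]
      gcongr
      exact (abs_sub _ _).trans (by gcongr; exact (abs_add_le _ _).trans (by gcongr))
    · intro x _ y _
      simp

/-- existence and uniqueness of a global solution of the soliton ODE
system, with `C` positive, bounded, monotone, and converging to a positive limit. -/
theorem statement7 (m : ℕ) (hm : m = 2 ∨ m = 3 ∨ m = 4)
    (lam : ℝ) (hlam0 : 0 ≤ lam) (hlam1 : lam < 1)
    (a : ℝ → ℝ) (ha : Admissible a) :
    ∃ ε₀ : ℝ, 0 < ε₀ ∧ ∀ eps : ℝ, 0 < eps → eps < ε₀ →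
      ∃ C P : ℝ → ℝ,
        IsSolODE m lam a eps C P ∧
        (∀ C' P' : ℝ → ℝ, IsSolODE m lam a eps C' P' →
          ∀ t ∈ Set.Ici (-Teps lam eps), C' t = C t ∧ P' t = P t) ∧
        (∀ t ∈ Set.Ici (-Teps lam eps), 0 < C t) ∧
        (∃ M : ℝ, ∀ t ∈ Set.Ici (-Teps lam eps), |C t| ≤ M) ∧
        (MonotoneOn C (Set.Ici (-Teps lam eps)) ∨ AntitoneOn C (Set.Ici (-Teps lam eps))) ∧
        ∃ L : ℝ, 0 < L ∧ Tendsto C atTop (nhds L) := by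
  obtain ⟨hl₀, hl₁, hk⟩ : 0 < lam0 m ∧ lam0 m < 1 ∧ 4 / ((m : ℝ) + 3) ≤ 1 := by
    rcases hm with rfl | rfl | rfl <;> norm_num [lam0]
  have hlam : lam ≤ lam / lam0 m := le_div_self hlam0 hl₀ hl₁.le
  refine ⟨1, one_pos, fun eps heps _ ↦ ?_⟩
  obtain ⟨C, P, hsol, hmono, c, d, hc, hb⟩ : ∃ C P : ℝ → ℝ, IsSolODE m lam a eps C P ∧
      (MonotoneOn C (Ici (-Teps lam eps)) ∨ AntitoneOn C (Ici (-Teps lam eps))) ∧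
      ∃ c d : ℝ, 0 < c ∧ ∀ t ∈ Ici (-Teps lam eps), c ≤ C t ∧ C t ≤ d := by
    rcases lt_trichotomy (lam / lam0 m) 1 with hmu | hmu | hmu
    · obtain ⟨C, P, hsol, hmono, hb⟩ := exists_isSolODE_monotoneOn ha heps hk hlam hmu
      exact ⟨C, P, hsol, Or.inl hmono, 1, 2, one_pos, hb⟩
    · exact ⟨_, _, isSolODE_const hmu, Or.inl monotoneOn_const, 1, 1, one_pos,
        fun _ _ ↦ ⟨le_rfl, le_rfl⟩⟩
    · obtain ⟨C, P, hsol, hanti, c, hc, hb⟩ := exists_isSolODE_antitoneOn ha heps hl₀ hl₁ hmu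
      exact ⟨C, P, hsol, Or.inr hanti, c, 1, hc, hb⟩
  have hpos (t : ℝ) (ht : t ∈ Ici (-Teps lam eps)) : 0 < C t := hc.trans_le (hb t ht).1
  obtain ⟨l, hl, hlim⟩ := exists_tendsto_atTop_of_monotoneOn_or_antitoneOn_Ici hmono hb
  exact ⟨C, P, hsol, fun C' P' h' t ht ↦ hsol.unique ha h' ht, hpos,
    ⟨d, fun t ht ↦ (abs_of_pos (hpos t ht)).trans_le (hb t ht).2⟩, hmono, l, hc.trans_le hl, hlim⟩
end

section
/- Let m ∈ {2,3,4}, 0 ≤ λ < 1, let a be an admissible potential, and let (C,P) be a C¹ solution on [−T_ε, +∞) of the soliton ODE system C' = ε f₁(C,P), P' = C − λ, C(−T_ε) = 1, P(−T_ε) = −(1−λ)T_ε, with C positive. Then: (i) if 0 ≤ λ < λ₀ then C(t) > λ/λ₀ and C'(t) > 0 for all t ≥ −T_ε (C is strictly increasing); (ii) if λ = λ₀ then C(t) = 1 and P(t) = (1−λ₀)t for all t ≥ −T_ε; (iii) if λ₀ < λ < 1 then 0 < C(t) < λ/λ₀ and C'(t) < 0 for all t ≥ −T_ε (C is strictly decreasing).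 -/
open Real Filter Set

/-- A function with zero right derivative on a half-line is constant there. -/
theorem eq_of_hasDerivWithinAt_Ici_zero {f : ℝ → ℝ} {s : ℝ}
    (hf : ∀ t ∈ Ici s, HasDerivWithinAt f 0 (Ici s) t) {t : ℝ} (ht : t ∈ Ici s) :
    f t = f s :=
  constant_of_has_deriv_right_zero (a := s) (b := t)
    (fun x hx => (hf x hx.1).continuousWithinAt.mono Icc_subset_Ici_self)
    (fun x hx => (hf x hx.1).mono (Ici_subset_Ici.2 hx.1)) t ⟨ht, le_rfl⟩

/-- A solution of the scalar linear equation `u' = g u` on a half-line is a positive multiple of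
its initial value. -/
theorem exists_pos_eq_mul_of_linear_ode {u g : ℝ → ℝ} {s : ℝ} (hg : ContinuousOn g (Ici s))
    (hu : ∀ t ∈ Ici s, HasDerivWithinAt u (g t * u t) (Ici s) t) {t : ℝ} (ht : t ∈ Ici s) :
    ∃ E : ℝ, 0 < E ∧ u t = u s * E := by
  have hcont : Continuous fun r => g (max s r) :=
    hg.comp_continuous (by fun_prop) fun r => le_max_left s r
  set G : ℝ → ℝ := fun r => ∫ x in s..r, g (max s x) with hG
  have hGd : ∀ r ∈ Ici s, HasDerivWithinAt G (g r) (Ici s) r := fun r hr => by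
    have h := (hcont.integral_hasStrictDerivAt s r).hasDerivAt.hasDerivWithinAt (s := Ici s)
    rwa [max_eq_right (mem_Ici.1 hr)] at h
  have hconst := eq_of_hasDerivWithinAt_Ici_zero (f := fun r => u r * Real.exp (-G r))
    (fun r hr => ((hu r hr).mul (hGd r hr).neg.exp).congr_deriv (by ring)) ht
  have hGs : G s = 0 := by simp [hG]
  simp only [hGs, neg_zero, Real.exp_zero, mul_one] at hconst
  refine ⟨Real.exp (G t), Real.exp_pos _, ?_⟩
  rw [← hconst, mul_assoc, ← Real.exp_add]
  simp

/-- trichotomy for the scaling parameter `C` of a positive solution of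
the soliton ODE system, according to the position of `λ` with respect to `λ₀`. -/
theorem statement8 (m : ℕ) (hm : m = 2 ∨ m = 3 ∨ m = 4)
    (lam : ℝ) (hlam0 : 0 ≤ lam) (hlam1 : lam < 1)
    (a : ℝ → ℝ) (ha : Admissible a) (eps : ℝ) (heps : 0 < eps)
    (C P : ℝ → ℝ) (hsol : IsSolODE m lam a eps C P)
    (hpos : ∀ t ∈ Set.Ici (-Teps lam eps), 0 < C t) :
    (lam < lam0 m →
      (∀ t ∈ Set.Ici (-Teps lam eps),
        lam / lam0 m < C t ∧ 0 < eps * f1 m lam a eps (C t) (P t)) ∧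
      StrictMonoOn C (Set.Ici (-Teps lam eps))) ∧
    (lam = lam0 m →
      ∀ t ∈ Set.Ici (-Teps lam eps), C t = 1 ∧ P t = (1 - lam0 m) * t) ∧
    (lam0 m < lam →
      (∀ t ∈ Set.Ici (-Teps lam eps),
        (0 < C t ∧ C t < lam / lam0 m) ∧ eps * f1 m lam a eps (C t) (P t) < 0) ∧
      StrictAntiOn C (Set.Ici (-Teps lam eps))) := by
  obtain ⟨hode, hC0, hP0⟩ := hsol
  obtain ⟨hsmooth, K, γ, -, -, hbd, -⟩ := ha
  set s : ℝ := -Teps lam eps with hs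
  have hl0 : 0 < lam0 m := by
    rcases hm with rfl | rfl | rfl <;> norm_num [lam0]
  have hda : Continuous (deriv a) := hsmooth.continuous_deriv (by norm_num)
  have hCc : ContinuousOn C (Ici s) := fun t ht => (hode t ht).1.continuousWithinAt
  have hPc : ContinuousOn P (Ici s) := fun t ht => (hode t ht).2.continuousWithinAt
  set g : ℝ → ℝ := fun t =>
    eps * (4 / ((m : ℝ) + 3) * C t * deriv a (eps * P t) / a (eps * P t)) with hg
  have hgc : ContinuousOn g (Ici s) := by
    have hεP : ContinuousOn (fun t => eps * P t) (Ici s) := continuousOn_const.mul hPc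
    exact continuousOn_const.mul (((continuousOn_const.mul hCc).mul
      (hda.comp_continuousOn hεP)).div (hsmooth.continuous.comp_continuousOn hεP)
      fun t _ => (zero_lt_one.trans (hbd (eps * P t)).1).ne')
  have hgpos : ∀ t ∈ Ici s, 0 < g t := fun t ht => by
    have h1 := hpos t ht
    have h2 := (hbd (eps * P t)).2.2
    have h3 : 0 < a (eps * P t) := zero_lt_one.trans (hbd (eps * P t)).1
    positivity
  have hf1 : ∀ t, eps * f1 m lam a eps (C t) (P t) = g t * (C t - lam / lam0 m) := fun t => by
    simp only [hg, f1]
    ring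
  have hsign : ∀ t ∈ Ici s, ∃ E : ℝ, 0 < E ∧ C t - lam / lam0 m = (1 - lam / lam0 m) * E :=
    fun t ht => by
      have h := exists_pos_eq_mul_of_linear_ode (u := fun r => C r - lam / lam0 m) hgc
        (fun r hr => by
          rw [← hf1]
          exact (hode r hr).1.sub_const _) ht
      simpa only [hC0] using h
  have hder : ∀ t ∈ interior (Ici s), HasDerivWithinAt C
      (eps * f1 m lam a eps (C t) (P t)) (interior (Ici s)) t := fun t ht =>
    (hode t (interior_subset ht)).1.mono interior_subset
  refine ⟨fun hlt => ?_, fun heq t ht => ?_, fun hgt => ?_⟩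
  · have hμ : 0 < 1 - lam / lam0 m := sub_pos.2 ((div_lt_one hl0).2 hlt)
    have key : ∀ t ∈ Ici s,
        lam / lam0 m < C t ∧ 0 < eps * f1 m lam a eps (C t) (P t) := fun t ht => by
      obtain ⟨E, hE, h⟩ := hsign t ht
      have hu : 0 < C t - lam / lam0 m := h ▸ mul_pos hμ hE
      exact ⟨sub_pos.1 hu, hf1 t ▸ mul_pos (hgpos t ht) hu⟩
    exact ⟨key, strictMonoOn_of_hasDerivWithinAt_pos (convex_Ici s) hCc hder
      fun t ht => (key t (interior_subset ht)).2⟩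
  · have hC1 : ∀ r ∈ Ici s, C r = 1 := fun r hr => by
      obtain ⟨E, -, h⟩ := hsign r hr
      rw [heq, div_self hl0.ne', sub_self, zero_mul] at h
      exact sub_eq_zero.1 h
    refine ⟨hC1 t ht, ?_⟩
    have h := eq_of_hasDerivWithinAt_Ici_zero (f := fun r => P r - (1 - lam) * r)
      (fun r hr => ((hode r hr).2.sub ((hasDerivWithinAt_id r _).const_mul (1 - lam))).congr_deriv
        (by rw [hC1 r hr]; ring)) ht
    simp only [hP0] at h
    rw [← heq]
    linear_combination h - (1 - lam) * hs
  · have hμ : 1 - lam / lam0 m < 0 := sub_neg.2 ((one_lt_div hl0).2 hgt)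
    have key : ∀ t ∈ Ici s, (0 < C t ∧ C t < lam / lam0 m) ∧
        eps * f1 m lam a eps (C t) (P t) < 0 := fun t ht => by
      obtain ⟨E, hE, h⟩ := hsign t ht
      have hu : C t - lam / lam0 m < 0 := h ▸ mul_neg_of_neg_of_pos hμ hE
      exact ⟨⟨hpos t ht, sub_neg.1 hu⟩, hf1 t ▸ mul_neg_of_pos_of_neg (hgpos t ht) hu⟩
    exact ⟨key, strictAntiOn_of_hasDerivWithinAt_neg (convex_Ici s) hCc hder
      fun t ht => (key t (interior_subset ht)).2⟩
end

section
/- Let m ∈ {2,3,4}, λ₀ = (5−m)/(m+3), 0 ≤ λ < 1, ε > 0, and let a : ℝ → ℝ be a positive C¹ function. Suppose (C,P) is a C¹ solution on an interval I of the system C'(t) = ε·(4/(m+3))·C(t)·(C(t) − λ/λ₀)·a'(εP(t))/a(εP(t)), P'(t) = C(t) − λ, such that C(t) > 0 and C(t) ≠ λ/λ₀ for all t ∈ I. Then the function t ↦ C(t)^{λ₀} · |λ/λ₀ − C(t)|^{1−λ₀} · a(εP(t))^{−4/(m+3)} is constant on I. -/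
open Real Filter Set

/-- The logarithm of a product of powers of `x > 0`, `|y| > 0` and `z > 0`, exponentiated. -/
theorem rpow_mul_abs_rpow_mul_rpow_eq_exp {x y z : ℝ} (hx : 0 < x) (hy : y ≠ 0) (hz : 0 < z)
    (p q r : ℝ) :
    x ^ p * |y| ^ q * z ^ r = exp (p * log x + q * log y + r * log z) := by
  rw [rpow_def_of_pos hx, rpow_def_of_pos (abs_pos.mpr hy), rpow_def_of_pos hz, log_abs,
    exp_add, exp_add, mul_comm p, mul_comm q, mul_comm r]

/-- A function whose derivative within a convex set vanishes is constant on that set. -/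
theorem Convex.eq_of_hasDerivWithinAt_zero {f : ℝ → ℝ} {I : Set ℝ} (hI : Convex ℝ I)
    (hf : ∀ t ∈ I, HasDerivWithinAt f 0 I t) {t s : ℝ} (ht : t ∈ I) (hs : s ∈ I) :
    f t = f s := by
  have h := hI.norm_image_sub_le_of_norm_hasDerivWithin_le (C := 0) hf (by simp) hs ht
  rw [zero_mul, norm_le_zero_iff] at h
  exact sub_eq_zero.mp h

/-- first integral of the soliton ODE system: the quantity
`C^{λ₀} |λ/λ₀ - C|^{1-λ₀} a(εP)^{-4/(m+3)}` is constant along solutions. -/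
theorem statement9 (m : ℕ) (hm : m = 2 ∨ m = 3 ∨ m = 4)
    (lam : ℝ) (hlam0 : 0 ≤ lam) (hlam1 : lam < 1)
    (eps : ℝ) (heps : 0 < eps)
    (a : ℝ → ℝ) (ha : ContDiff ℝ 1 a) (hapos : ∀ r : ℝ, 0 < a r)
    (I : Set ℝ) (hI : Convex ℝ I) (C P : ℝ → ℝ)
    (hODE : ∀ t ∈ I,
      HasDerivWithinAt C (eps * f1 m lam a eps (C t) (P t)) I t ∧
      HasDerivWithinAt P (C t - lam) I t)
    (hCpos : ∀ t ∈ I, 0 < C t) (hCne : ∀ t ∈ I, C t ≠ lam / lam0 m) :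
    ∀ t ∈ I, ∀ s ∈ I,
      C t ^ lam0 m * |lam / lam0 m - C t| ^ (1 - lam0 m)
          * a (eps * P t) ^ (-(4 : ℝ) / ((m : ℝ) + 3))
        = C s ^ lam0 m * |lam / lam0 m - C s| ^ (1 - lam0 m)
          * a (eps * P s) ^ (-(4 : ℝ) / ((m : ℝ) + 3)) := by
  have hl0 : lam0 m ≠ 0 := by
    rcases hm with rfl | rfl | rfl <;> norm_num [lam0]
  have hm3 : (m : ℝ) + 3 ≠ 0 := by positivity
  have hsub : ∀ t ∈ I, lam / lam0 m - C t ≠ 0 := fun t ht =>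
    sub_ne_zero.mpr (hCne t ht).symm
  intro t ht s hs
  rw [rpow_mul_abs_rpow_mul_rpow_eq_exp (hCpos t ht) (hsub t ht) (hapos _),
    rpow_mul_abs_rpow_mul_rpow_eq_exp (hCpos s hs) (hsub s hs) (hapos _)]
  refine congrArg exp (hI.eq_of_hasDerivWithinAt_zero (f := fun u =>
    lam0 m * log (C u) + (1 - lam0 m) * log (lam / lam0 m - C u)
      + -(4 : ℝ) / ((m : ℝ) + 3) * log (a (eps * P u))) (fun u hu => ?_) ht hs)
  obtain ⟨hC, hP⟩ := hODE u hu
  have hda : HasDerivAt a (deriv a (eps * P u)) (eps * P u) :=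
    (ha.differentiable one_ne_zero _).hasDerivAt
  have haP : HasDerivWithinAt (fun v => a (eps * P v))
      (deriv a (eps * P u) * (eps * (C u - lam))) I u :=
    hda.comp_hasDerivWithinAt u (hP.const_mul eps)
  have hC0 : C u ≠ 0 := (hCpos u hu).ne'
  have hk := hsub u hu
  have ha0 : a (eps * P u) ≠ 0 := (hapos _).ne'
  refine ((((hC.log hC0).const_mul (lam0 m)).add
    (((hC.const_sub (lam / lam0 m)).log hk).const_mul (1 - lam0 m))).add
    ((haP.log ha0).const_mul (-(4 : ℝ) / ((m : ℝ) + 3)))).congr_deriv ?_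
  have hlam : lam = lam0 m * (lam / lam0 m) := by field_simp
  unfold f1
  generalize lam / lam0 m = k at hk hlam ⊢
  rw [hlam]
  field_simp
  ring
end

section
/- Let m ∈ {2,3,4}, λ₀ = (5−m)/(m+3), and let λ̃ ∈ (λ₀,1) be the unique solution of λ̃((1−λ₀)/(λ̃−λ₀))^{1−λ₀} = 2^{4/(m+3)}. For every λ with 0 < λ < λ̃ and λ ≠ λ₀ there exists a unique real number c_∞ > λ with (λ − c_∞λ₀)/(λ − λ₀) > 0 satisfying c_∞^{λ₀} · ((λ − c_∞λ₀)/(λ − λ₀))^{1−λ₀} = 2^{4/(m+3)}. Moreover c_∞ > 1 if 0 < λ < λ₀, and λ < c_∞ < 1 if λ₀ < λ < λ̃. -/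
open Real

/-- The left-hand side of the final scaling equation, as a function of the scaling `c`. -/
noncomputable def finalScaling (a lam c : ℝ) : ℝ :=
  c ^ a * ((lam - c * a) / (lam - a)) ^ (1 - a)

lemma continuous_finalScaling {a lam : ℝ} (ha0 : 0 < a) (ha1 : a < 1) :
    Continuous (finalScaling a lam) := by
  unfold finalScaling
  refine (Real.continuous_rpow_const ha0.le).mul
    ((Real.continuous_rpow_const (sub_nonneg.2 ha1.le)).comp ?_)
  fun_prop

lemma finalScaling_one {a lam : ℝ} (hne : lam ≠ a) : finalScaling a lam 1 = 1 := by
  simp [finalScaling, div_self (sub_ne_zero.2 hne)]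

lemma finalScaling_lt_of_lt {a lam c d : ℝ} (ha0 : 0 < a) (ha1 : a < 1) (hlam : lam < a)
    (hc0 : 0 < c) (hc : 0 < (lam - c * a) / (lam - a)) (hcd : c < d) :
    finalScaling a lam c < finalScaling a lam d := by
  have h : (lam - c * a) / (lam - a) < (lam - d * a) / (lam - a) :=
    div_lt_div_of_neg_of_lt (sub_neg.2 hlam) (by nlinarith)
  exact mul_lt_mul'' (rpow_lt_rpow hc0.le hcd ha0) (rpow_lt_rpow hc.le h (sub_pos.2 ha1))
    (by positivity) (by positivity)

lemma finalScaling_gt_of_lt {a lam c d : ℝ} (ha0 : 0 < a) (ha1 : a < 1) (hlam : a < lam)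
    (hc : lam < c) (hcd : c < d) (hd : 0 < (lam - d * a) / (lam - a)) :
    finalScaling a lam d < finalScaling a lam c := by
  have hla : 0 < lam - a := sub_pos.2 hlam
  have hc0 : 0 < c := by linarith
  have hd0 : 0 < d := by linarith
  have hd' : 0 < lam - d * a := (div_pos_iff_of_pos_right hla).1 hd
  have hc' : 0 < lam - c * a := by nlinarith
  have key : (d / c) ^ a * ((lam - d * a) / (lam - c * a)) ^ (1 - a) < 1 := by
    refine (geom_mean_le_arith_mean2_weighted ha0.le (sub_nonneg.2 ha1.le) (by positivity)
      (by positivity) (by ring)).trans_lt ?_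
    rw [← sub_pos]
    have : 1 - (a * (d / c) + (1 - a) * ((lam - d * a) / (lam - c * a)))
        = a * (d - c) * (c - lam) / (c * (lam - c * a)) := by
      have hd_eq : lam - d * a = (lam - c * a) - a * (d - c) := by ring
      have hc_eq : c - lam = (1 - a) * c - (lam - c * a) := by ring
      rw [hd_eq, hc_eq]
      generalize lam - c * a = e at hc'
      field_simp
      ring
    rw [this]
    have := sub_pos.2 hcd
    have := sub_pos.2 hc
    positivity
  rw [div_rpow hd0.le hc0.le, div_rpow hd'.le hc'.le, div_mul_div_comm,
    div_lt_one (by positivity)] at key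
  unfold finalScaling
  rw [div_rpow hd'.le hla.le, div_rpow hc'.le hla.le, ← mul_div_assoc, ← mul_div_assoc]
  gcongr

lemma finalScaling_self {a lam : ℝ} (ha0 : 0 < a) (ha1 : a < 1) (hlam : a < lam) :
    finalScaling a lam lam = lam * ((1 - a) / (lam - a)) ^ (1 - a) := by
  have hl : 0 < lam := ha0.trans hlam
  have h : (lam - lam * a) / (lam - a) = lam * ((1 - a) / (lam - a)) := by ring
  rw [finalScaling, h, mul_rpow hl.le (div_nonneg (by linarith) (by linarith)), ← mul_assoc,
    ← rpow_add hl, add_sub_cancel, rpow_one]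

lemma mul_div_rpow_lt_of_lt {a s t : ℝ} (ha0 : 0 < a) (hs : a < s) (hst : s < t) (ht : t < 1) :
    t * ((1 - a) / (t - a)) ^ (1 - a) < s * ((1 - a) / (s - a)) ^ (1 - a) := by
  have hsa : 0 < s - a := by linarith
  have hta : 0 < t - a := by linarith
  have h1a : 0 < 1 - a := by linarith
  have ht0 : 0 < t := by linarith
  have key : ((s - a) / (t - a)) ^ (1 - a) < s / t := by
    have h := geom_mean_le_arith_mean2_weighted ha0.le h1a.le zero_le_one
      (by positivity : 0 ≤ (s - a) / (t - a)) (by ring)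
    rw [one_rpow, one_mul] at h
    refine h.trans_lt ?_
    rw [← sub_pos]
    have : s / t - (a * 1 + (1 - a) * ((s - a) / (t - a)))
        = a * (t - s) * (1 - t) / (t * (t - a)) := by
      field_simp
      ring
    rw [this]
    have := sub_pos.2 hst
    have := sub_pos.2 ht
    positivity
  rw [div_rpow hsa.le hta.le, div_lt_div_iff₀ (by positivity) ht0] at key
  rw [div_rpow h1a.le hta.le, div_rpow h1a.le hsa.le, ← mul_div_assoc, ← mul_div_assoc,
    div_lt_div_iff₀ (by positivity) (by positivity)]
  have := mul_lt_mul_of_pos_left key (rpow_pos_of_pos h1a (1 - a))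
  linarith

lemma finalScaling_of_lt {a lam K : ℝ} (ha0 : 0 < a) (ha1 : a < 1) (hK : 1 < K)
    (hlam0 : 0 < lam) (hlam : lam < a) :
    (∃! c : ℝ, lam < c ∧ 0 < (lam - c * a) / (lam - a) ∧ finalScaling a lam c = K) ∧
    ∀ c : ℝ, (lam < c ∧ 0 < (lam - c * a) / (lam - a) ∧ finalScaling a lam c = K) → 1 < c := by
  have hla : lam - a < 0 := sub_neg.2 hlam
  have h1 : finalScaling a lam 1 = 1 := finalScaling_one hlam.ne
  have hK0 : 0 < K := by linarith
  have hbig : K ≤ finalScaling a lam K := by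
    have h : K ≤ (lam - K * a) / (lam - a) := by
      rw [le_div_iff_of_neg hla]
      nlinarith
    calc K = K ^ a * K ^ (1 - a) := by rw [← rpow_add hK0, add_sub_cancel, rpow_one]
      _ ≤ _ := mul_le_mul_of_nonneg_left (rpow_le_rpow hK0.le h (by linarith)) (by positivity)
  obtain ⟨c, ⟨hc1, -⟩, hcK⟩ := intermediate_value_Icc hK.le
    (continuous_finalScaling (lam := lam) ha0 ha1).continuousOn ⟨h1.trans_le hK.le, hbig⟩
  refine ⟨⟨c, ⟨by linarith, div_pos_of_neg_of_neg (by nlinarith) hla, hcK⟩, ?_⟩, ?_⟩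
  · rintro d ⟨hd, hdpos, hdK⟩
    rcases lt_trichotomy d c with h | h | h
    · have := finalScaling_lt_of_lt ha0 ha1 hlam (hlam0.trans hd) hdpos h
      linarith
    · exact h
    · have := finalScaling_lt_of_lt ha0 ha1 hlam (by linarith)
        (div_pos_of_neg_of_neg (by nlinarith) hla) h
      linarith
  · rintro d ⟨hd, hdpos, hdK⟩
    by_contra! h
    rcases h.eq_or_lt with rfl | h
    · linarith
    · have := finalScaling_lt_of_lt ha0 ha1 hlam (hlam0.trans hd) hdpos h
      linarith

lemma finalScaling_of_gt {a lam K : ℝ} (ha0 : 0 < a) (ha1 : a < 1) (hK : 1 < K)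
    (hlam : a < lam) (hlam1 : lam < 1) (hself : K < finalScaling a lam lam) :
    (∃! c : ℝ, lam < c ∧ 0 < (lam - c * a) / (lam - a) ∧ finalScaling a lam c = K) ∧
    ∀ c : ℝ, (lam < c ∧ 0 < (lam - c * a) / (lam - a) ∧ finalScaling a lam c = K) → c < 1 := by
  have hla : 0 < lam - a := sub_pos.2 hlam
  have h1 : finalScaling a lam 1 = 1 := finalScaling_one hlam.ne'
  obtain ⟨c, ⟨hlc, hc1⟩, hcK⟩ := intermediate_value_Icc' hlam1.le
    (continuous_finalScaling (lam := lam) ha0 ha1).continuousOn ⟨h1.trans_le hK.le, hself.le⟩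
  have hlc : lam < c := by
    refine hlc.lt_of_ne ?_
    rintro rfl
    linarith
  have hcpos : 0 < (lam - c * a) / (lam - a) := div_pos (by nlinarith) hla
  refine ⟨⟨c, ⟨hlc, hcpos, hcK⟩, ?_⟩, ?_⟩
  · rintro d ⟨hd, hdpos, hdK⟩
    rcases lt_trichotomy d c with h | h | h
    · have := finalScaling_gt_of_lt ha0 ha1 hlam hd h hcpos
      linarith
    · exact h
    · have := finalScaling_gt_of_lt ha0 ha1 hlam hlc h hdpos
      linarith
  · rintro d ⟨hd, hdpos, hdK⟩
    by_contra! h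
    rcases h.eq_or_lt with rfl | h
    · linarith
    · have := finalScaling_gt_of_lt ha0 ha1 hlam hlam1 h hdpos
      linarith

/-- for `0 < λ < λ̃`, `λ ≠ λ₀`, there is a unique final scaling
`c_∞ > λ` with `(λ - c_∞λ₀)/(λ-λ₀) > 0` satisfying
`c_∞^{λ₀}((λ - c_∞λ₀)/(λ-λ₀))^{1-λ₀} = 2^{4/(m+3)}`; moreover `c_∞ > 1` when
`λ < λ₀` and `λ < c_∞ < 1` when `λ₀ < λ < λ̃`. -/
theorem statement11 (m : ℕ) (hm : m = 2 ∨ m = 3 ∨ m = 4)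
    (tl : ℝ) (htl0 : lam0 m < tl) (htl1 : tl < 1)
    (htl : tl * ((1 - lam0 m) / (tl - lam0 m)) ^ (1 - lam0 m)
      = (2 : ℝ) ^ ((4 : ℝ) / ((m : ℝ) + 3)))
    (lam : ℝ) (hlam0 : 0 < lam) (hlam1 : lam < tl) (hne : lam ≠ lam0 m) :
    (∃! c : ℝ, lam < c ∧ 0 < (lam - c * lam0 m) / (lam - lam0 m) ∧
      c ^ lam0 m * ((lam - c * lam0 m) / (lam - lam0 m)) ^ (1 - lam0 m)
        = (2 : ℝ) ^ ((4 : ℝ) / ((m : ℝ) + 3))) ∧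
    ∀ c : ℝ,
      (lam < c ∧ 0 < (lam - c * lam0 m) / (lam - lam0 m) ∧
        c ^ lam0 m * ((lam - c * lam0 m) / (lam - lam0 m)) ^ (1 - lam0 m)
          = (2 : ℝ) ^ ((4 : ℝ) / ((m : ℝ) + 3))) →
      (lam < lam0 m → 1 < c) ∧ (lam0 m < lam → lam < c ∧ c < 1) := by
  have ha0 : 0 < lam0 m := by rcases hm with rfl | rfl | rfl <;> norm_num [lam0]
  have ha1 : lam0 m < 1 := htl0.trans htl1
  have hK : (1 : ℝ) < 2 ^ ((4 : ℝ) / ((m : ℝ) + 3)) :=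
    one_lt_rpow one_lt_two (by positivity)
  rcases hne.lt_or_gt with h | h
  · obtain ⟨hex, hgt⟩ := finalScaling_of_lt ha0 ha1 hK hlam0 h
    exact ⟨hex, fun c hc => ⟨fun _ => hgt c hc, fun h' => absurd h' h.not_gt⟩⟩
  · obtain ⟨hex, hlt⟩ := finalScaling_of_gt ha0 ha1 hK h (hlam1.trans htl1) (by
      rw [finalScaling_self ha0 ha1 h, ← htl]
      exact mul_div_rpow_lt_of_lt ha0 h hlam1 htl1)
    exact ⟨hex, fun c hc => ⟨fun h' => absurd h' h.not_gt, fun _ => ⟨hc.1, hlt c hc⟩⟩⟩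
end

section
/- Let m ∈ {2,3,4}, λ₀ = (5−m)/(m+3), and let λ̃ ∈ (λ₀,1) be the unique solution of λ̃((1−λ₀)/(λ̃−λ₀))^{1−λ₀} = 2^{4/(m+3)}. For every λ with λ̃ < λ < 1 there exists a unique real number c_∞ with 0 < c_∞ < λ satisfying c_∞^{λ₀} · ((λ − c_∞λ₀)/(λ − λ₀))^{1−λ₀} = 1. -/
open Real

/-- The scaling map `c ↦ c ^ a * ((l - c * a) / (l - a)) ^ (1 - a)` is strictly increasing
on `(0, l)`. -/
theorem scaling_lt_scaling {a l c d : ℝ} (ha0 : 0 < a) (ha1 : a < 1) (hal : a < l)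
    (hc : 0 < c) (hcd : c < d) (hd : d < l) :
    c ^ a * ((l - c * a) / (l - a)) ^ (1 - a) < d ^ a * ((l - d * a) / (l - a)) ^ (1 - a) := by
  have hd0 : 0 < d := hc.trans hcd
  have hla : 0 < l - a := sub_pos.2 hal
  have hD : 0 < l - d * a := by nlinarith
  have hC : 0 < l - c * a := by nlinarith
  have amgm := Real.geom_mean_le_arith_mean2_weighted ha0.le (sub_pos.2 ha1).le
    (div_pos hc hd0).le (div_pos hC hD).le (by ring)
  have hlin : a * (c / d) + (1 - a) * ((l - c * a) / (l - d * a)) < 1 := by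
    have h : 1 - (a * (c / d) + (1 - a) * ((l - c * a) / (l - d * a)))
        = a * (d - c) * (l - d) / (d * (l - d * a)) := by
      obtain ⟨D, hDl⟩ : ∃ D, D = l - d * a := ⟨_, rfl⟩
      obtain rfl : l = D + d * a := by linarith
      rw [← hDl] at hD ⊢
      field_simp
      ring
    have : 0 < a * (d - c) * (l - d) / (d * (l - d * a)) :=
      div_pos (mul_pos (mul_pos ha0 (sub_pos.2 hcd)) (sub_pos.2 hd)) (mul_pos hd0 hD)
    linarith
  have hlt := amgm.trans_lt hlin
  rw [Real.div_rpow hc.le hd0.le, Real.div_rpow hC.le hD.le, div_mul_div_comm,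
    div_lt_one (by positivity)] at hlt
  rw [Real.div_rpow hC.le hla.le, Real.div_rpow hD.le hla.le, ← mul_div_assoc, ← mul_div_assoc]
  gcongr

/-- The scaling map exceeds `1` at the right endpoint `c = l`. -/
theorem one_lt_scaling_self {a l : ℝ} (ha0 : 0 < a) (hal : a < l) (hl : l < 1) :
    1 < l ^ a * ((l - l * a) / (l - a)) ^ (1 - a) := by
  have hl0 : 0 < l := ha0.trans hal
  have ha1 : 0 < 1 - a := by linarith
  have hla : 0 < l - a := sub_pos.2 hal
  have hx : 0 < (l - a) / (1 - a) := div_pos hla ha1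
  have bern : ((l - a) / (1 - a)) ^ (1 - a) < l := by
    have h := rpow_one_add_lt_one_add_mul_self (s := (l - a) / (1 - a) - 1) (p := 1 - a)
      (by linarith) (by rw [sub_ne_zero, Ne, div_eq_one_iff_eq ha1.ne']; linarith) ha1
      (by linarith)
    rwa [add_sub_cancel, mul_sub, mul_div_cancel₀ _ ha1.ne',
      show 1 + (l - a - (1 - a) * 1) = l by ring] at h
  have heq : (l - l * a) / (l - a) = l / ((l - a) / (1 - a)) := by
    field_simp
  rw [heq, Real.div_rpow hl0.le hx.le, ← mul_div_assoc, ← Real.rpow_add hl0, add_sub_cancel,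
    Real.rpow_one, one_lt_div (by positivity)]
  exact bern

theorem existsUnique_scaling_eq_one {a l : ℝ} (ha0 : 0 < a) (hal : a < l) (hl : l < 1) :
    ∃! c : ℝ, 0 < c ∧ c < l ∧ c ^ a * ((l - c * a) / (l - a)) ^ (1 - a) = 1 := by
  have hl0 : 0 < l := ha0.trans hal
  have ha1 : a < 1 := hal.trans hl
  have hend := one_lt_scaling_self ha0 hal hl
  have hcont : Continuous fun c : ℝ => c ^ a * ((l - c * a) / (l - a)) ^ (1 - a) :=
    (Real.continuous_rpow_const ha0.le).mul
      ((Real.continuous_rpow_const (sub_pos.2 ha1).le).comp (by fun_prop))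
  obtain ⟨c, ⟨hc0, hcl⟩, hc⟩ := intermediate_value_Ioo hl0.le hcont.continuousOn
    (show (1 : ℝ) ∈ _ from ⟨by simp [Real.zero_rpow ha0.ne'], hend⟩)
  refine ⟨c, ⟨hc0, hcl, hc⟩, ?_⟩
  rintro d ⟨hd0, hdl, hd⟩
  rcases lt_trichotomy d c with h | h | h
  · exact absurd (hd.trans hc.symm) (scaling_lt_scaling ha0 ha1 hal hd0 h hcl).ne
  · exact h
  · exact absurd (hc.trans hd.symm) (scaling_lt_scaling ha0 ha1 hal hc0 h hdl).ne

/-- for `λ̃ < λ < 1` there is a unique final scaling `c_∞ ∈ (0, λ)`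
with `c_∞^{λ₀}((λ - c_∞λ₀)/(λ-λ₀))^{1-λ₀} = 1`. -/
theorem statement12 (m : ℕ) (hm : m = 2 ∨ m = 3 ∨ m = 4)
    (tl : ℝ) (htl0 : lam0 m < tl) (htl1 : tl < 1)
    (htl : tl * ((1 - lam0 m) / (tl - lam0 m)) ^ (1 - lam0 m)
      = (2 : ℝ) ^ ((4 : ℝ) / ((m : ℝ) + 3)))
    (lam : ℝ) (hlam0 : tl < lam) (hlam1 : lam < 1) :
    ∃! c : ℝ, 0 < c ∧ c < lam ∧
      c ^ lam0 m * ((lam - c * lam0 m) / (lam - lam0 m)) ^ (1 - lam0 m) = 1 := by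
  have ha0 : 0 < lam0 m := by
    rcases hm with rfl | rfl | rfl <;> norm_num [lam0]
  exact existsUnique_scaling_eq_one ha0 (htl0.trans hlam0) hlam1
end

section
/- Let m ∈ {2,3,4}, let a be an admissible potential, and let λ̃ ∈ (λ₀,1) be the unique solution of λ̃((1−λ₀)/(λ̃−λ₀))^{1−λ₀} = 2^{4/(m+3)}. There exists ε₀ > 0 such that for all 0 < ε < ε₀ and all λ with 0 ≤ λ ≤ λ̃, the solution (C,P) on [−T_ε, +∞) of the soliton ODE system C' = ε f₁(C,P), P' = C − λ, C(−T_ε) = 1, P(−T_ε) = −(1−λ)T_ε satisfies lim_{t→+∞} C(t) > λ and lim_{t→+∞} P(t) = +∞. -/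
open Real Filter Set

/-- Solutions of `u' = β u` on a half-line are
multiples of an exponential. -/
theorem eq_mul_exp_of_hasDerivWithinAt_Ici {t₀ : ℝ} {u β : ℝ → ℝ}
    (hβ : ContinuousOn β (Ici t₀))
    (hu : ∀ t ∈ Ici t₀, HasDerivWithinAt u (β t * u t) (Ici t₀) t) :
    ∃ B : ℝ → ℝ, ∀ t ∈ Ici t₀, u t = u t₀ * exp (B t) := by
  have hcont : Continuous fun t => β (max t₀ t) :=
    hβ.comp_continuous (by fun_prop) fun t => mem_Ici.2 (le_max_left _ _)
  set B : ℝ → ℝ := fun t => ∫ s in t₀..t, β (max t₀ s) with hB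
  have hBd : ∀ t, HasDerivAt B (β (max t₀ t)) t := fun t =>
    intervalIntegral.integral_hasDerivAt_right (hcont.intervalIntegrable _ _)
      (hcont.stronglyMeasurableAtFilter _ _) hcont.continuousAt
  have hv : ∀ t ∈ Ici t₀, HasDerivWithinAt (fun t => u t * exp (-B t)) 0 (Ici t₀) t := by
    intro t ht
    have h := (hu t ht).mul (hBd t).neg.exp.hasDerivWithinAt
    rw [max_eq_right (mem_Ici.1 ht)] at h
    exact h.congr_deriv (by ring)
  refine ⟨B, fun t ht => ?_⟩
  have hconst := constant_of_has_deriv_right_zero (a := t₀) (b := t)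
    (fun x hx => ((hv x hx.1).continuousWithinAt).mono Icc_subset_Ici_self)
    (fun x hx => (hv x hx.1).mono (Ici_subset_Ici.2 hx.1)) t ⟨ht, le_rfl⟩
  have hB0 : B t₀ = 0 := by simp [hB]
  simp only [hB0, neg_zero, exp_zero, mul_one] at hconst
  rw [← hconst, mul_assoc, ← exp_add]
  simp

theorem MonotoneOn.exists_tendsto_atTop_of_le {t₀ M : ℝ} {f : ℝ → ℝ}
    (hf : MonotoneOn f (Ici t₀)) (hM : ∀ t ∈ Ici t₀, f t ≤ M) :
    ∃ L, Tendsto f atTop (nhds L) := by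
  have hmono : Monotone fun t => f (max t₀ t) := fun x y hxy =>
    hf (mem_Ici.2 (le_max_left _ _)) (mem_Ici.2 (le_max_left _ _)) (max_le_max le_rfl hxy)
  have hbdd : BddAbove (range fun t => f (max t₀ t)) :=
    ⟨M, by rintro _ ⟨t, rfl⟩; exact hM _ (mem_Ici.2 (le_max_left _ _))⟩
  refine ⟨_, (tendsto_atTop_ciSup hmono hbdd).congr' ?_⟩
  filter_upwards [eventually_ge_atTop t₀] with t ht
  rw [max_eq_right ht]

theorem AntitoneOn.exists_tendsto_atTop_of_le {t₀ M : ℝ} {f : ℝ → ℝ}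
    (hf : AntitoneOn f (Ici t₀)) (hM : ∀ t ∈ Ici t₀, M ≤ f t) :
    ∃ L, Tendsto f atTop (nhds L) := by
  obtain ⟨L, hL⟩ := MonotoneOn.exists_tendsto_atTop_of_le hf.neg
    fun t ht => neg_le_neg (hM t ht)
  exact ⟨-L, by simpa using hL.neg⟩

theorem tendsto_atTop_of_le_hasDerivWithinAt {t₀ δ : ℝ} {P P' : ℝ → ℝ} (hδ : 0 < δ)
    (hP : ∀ t ∈ Ici t₀, HasDerivWithinAt P (P' t) (Ici t₀) t)
    (hP' : ∀ t ∈ Ici t₀, δ ≤ P' t) : Tendsto P atTop atTop := by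
  have hd : ∀ t ∈ Ici t₀, HasDerivWithinAt (fun t => P t - δ * t) (P' t - δ) (Ici t₀) t := by
    intro t ht
    exact ((hP t ht).sub ((hasDerivWithinAt_id t (Ici t₀)).const_mul δ)).congr_deriv (by simp)
  have hmono : MonotoneOn (fun t => P t - δ * t) (Ici t₀) :=
    monotoneOn_of_hasDerivWithinAt_nonneg (convex_Ici t₀)
      (fun t ht => (hd t ht).continuousWithinAt)
      (fun t ht => (hd t (interior_subset ht)).mono interior_subset)
      (fun t ht => sub_nonneg.2 (hP' t (interior_subset ht)))
  have hlin : Tendsto (fun t => δ * t + (P t₀ - δ * t₀)) atTop atTop :=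
    tendsto_atTop_add_const_right _ _ (tendsto_id.const_mul_atTop hδ)
  refine tendsto_atTop_mono' _ ?_ hlin
  filter_upwards [eventually_ge_atTop t₀] with t ht
  have := hmono self_mem_Ici ht ht
  simp only at this
  linarith

section Reduced

variable {l lam t₀ D : ℝ} {C A b : ℝ → ℝ}

/-- The first integral `l log C + (1 - l) log |C - lam / l| - A`. -/
theorem log_first_integral (hl : 0 < l)
    (hC : ∀ t ∈ Ici t₀, HasDerivWithinAt C (b t * C t * (C t - lam / l)) (Ici t₀) t)
    (hA : ∀ t ∈ Ici t₀, HasDerivWithinAt A (b t * (C t - lam)) (Ici t₀) t)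
    (hpos : ∀ t ∈ Ici t₀, 0 < C t) (hne : ∀ t ∈ Ici t₀, C t - lam / l ≠ 0)
    {t : ℝ} (ht : t ∈ Ici t₀) :
    l * log (C t) + (1 - l) * log (C t - lam / l) - A t =
      l * log (C t₀) + (1 - l) * log (C t₀ - lam / l) - A t₀ := by
  have hd : ∀ s ∈ Ici t₀, HasDerivWithinAt
      (fun s => l * log (C s) + (1 - l) * log (C s - lam / l) - A s) 0 (Ici t₀) s := by
    intro s hs
    have h1 := ((hC s hs).log (hpos s hs).ne').const_mul l
    have h2 := (((hC s hs).sub_const (lam / l)).log (hne s hs)).const_mul (1 - l)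
    refine ((h1.add h2).sub (hA s hs)).congr_deriv ?_
    have e1 : b s * C s * (C s - lam / l) / C s = b s * (C s - lam / l) := by
      field_simp [(hpos s hs).ne']
    have e2 : b s * C s * (C s - lam / l) / (C s - lam / l) = b s * C s :=
      mul_div_cancel_right₀ _ (hne s hs)
    rw [e1, e2]
    field_simp
    ring
  exact constant_of_has_deriv_right_zero (a := t₀) (b := t)
    (fun x hx => ((hd x hx.1).continuousWithinAt).mono Icc_subset_Ici_self)
    (fun x hx => (hd x hx.1).mono (Ici_subset_Ici.2 hx.1)) t ⟨ht, le_rfl⟩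

theorem reduced_system_converges (hl : 0 < l) (hl1 : l < 1) (hlam1 : lam < 1)
    (hC0 : C t₀ = 1)
    (hC : ∀ t ∈ Ici t₀, HasDerivWithinAt C (b t * C t * (C t - lam / l)) (Ici t₀) t)
    (hb : ContinuousOn b (Ici t₀)) (hb0 : ∀ t ∈ Ici t₀, 0 ≤ b t)
    (hA : ∀ t ∈ Ici t₀, HasDerivWithinAt A (b t * (C t - lam)) (Ici t₀) t)
    (hAD : ∀ t ∈ Ici t₀, A t - A t₀ ≤ D)
    (hD : l < lam → (1 - l) * log (1 - lam / l) + D <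
      l * log lam + (1 - l) * log (lam - lam / l)) :
    ∃ δ > 0, (∀ t ∈ Ici t₀, δ ≤ C t - lam) ∧ ∃ L, Tendsto C atTop (nhds L) := by
  have hCc : ContinuousOn C (Ici t₀) := fun t ht => (hC t ht).continuousWithinAt
  obtain ⟨B₁, hB₁⟩ := eq_mul_exp_of_hasDerivWithinAt_Ici (u := C)
    (β := fun t => b t * (C t - lam / l)) (hb.mul (hCc.sub continuousOn_const))
    (fun t ht => (hC t ht).congr_deriv (by ring))
  obtain ⟨B₂, hB₂⟩ := eq_mul_exp_of_hasDerivWithinAt_Ici (u := fun t => C t - lam / l)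
    (β := fun t => b t * C t) (hb.mul hCc) (fun t ht => (hC t ht).sub_const _)
  have hpos : ∀ t ∈ Ici t₀, 0 < C t := fun t ht => by
    rw [hB₁ t ht, hC0]; positivity
  have hint : ∀ t ∈ interior (Ici t₀), HasDerivWithinAt C (b t * C t * (C t - lam / l))
      (interior (Ici t₀)) t :=
    fun t ht => (hC t (interior_subset ht)).mono interior_subset
  simp only [hC0] at hB₂
  rcases lt_trichotomy lam l with h | h | h
  · have hμ : lam / l < 1 := (div_lt_one hl).2 h
    have hu : ∀ t ∈ Ici t₀, 0 < C t - lam / l := fun t ht => by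
      rw [hB₂ t ht]; exact mul_pos (by linarith) (exp_pos _)
    have hmono : MonotoneOn C (Ici t₀) :=
      monotoneOn_of_hasDerivWithinAt_nonneg (convex_Ici t₀) hCc hint fun t ht =>
        mul_nonneg (mul_nonneg (hb0 t (interior_subset ht)) (hpos t (interior_subset ht)).le)
          (hu t (interior_subset ht)).le
    have hge : ∀ t ∈ Ici t₀, 1 ≤ C t := fun t ht => hC0 ▸ hmono self_mem_Ici ht ht
    refine ⟨1 - lam, by linarith, fun t ht => by linarith [hge t ht],
      hmono.exists_tendsto_atTop_of_le
        (M := lam / l + exp (((1 - l) * log (1 - lam / l) + D) / (1 - l))) fun t ht => ?_⟩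
    have hfi := log_first_integral hl hC hA hpos (fun t ht => (hu t ht).ne') ht
    simp only [hC0, log_one, mul_zero, zero_add] at hfi
    have hlog := mul_nonneg hl.le (log_nonneg (hge t ht))
    have : log (C t - lam / l) ≤ ((1 - l) * log (1 - lam / l) + D) / (1 - l) := by
      rw [le_div_iff₀ (by linarith)]
      linarith [hAD t ht]
    rw [log_le_iff_le_exp (hu t ht)] at this
    linarith
  · have hone : ∀ t ∈ Ici t₀, C t = 1 := fun t ht => by
      have := hB₂ t ht
      rw [h, div_self hl.ne', sub_self, zero_mul] at this
      linarith
    refine ⟨1 - lam, by linarith, fun t ht => by rw [hone t ht], 1,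
      tendsto_const_nhds.congr' ?_⟩
    filter_upwards [eventually_ge_atTop t₀] with t ht using (hone t ht).symm
  · have hμ : 1 < lam / l := (one_lt_div hl).2 h
    have hu : ∀ t ∈ Ici t₀, C t - lam / l < 0 := fun t ht => by
      rw [hB₂ t ht]; exact mul_neg_of_neg_of_pos (by linarith) (exp_pos _)
    have hanti : AntitoneOn C (Ici t₀) :=
      antitoneOn_of_hasDerivWithinAt_nonpos (convex_Ici t₀) hCc hint fun t ht =>
        mul_nonpos_of_nonneg_of_nonpos
          (mul_nonneg (hb0 t (interior_subset ht)) (hpos t (interior_subset ht)).le)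
          (hu t (interior_subset ht)).le
    have hfi : ∀ t ∈ Ici t₀, l * log (C t) + (1 - l) * log (C t - lam / l) ≤
        (1 - l) * log (1 - lam / l) + D := fun t ht => by
      have := log_first_integral hl hC hA hpos (fun t ht => (hu t ht).ne) ht
      simp only [hC0, log_one, mul_zero, zero_add] at this
      linarith [hAD t ht]
    have hgt : ∀ t ∈ Ici t₀, lam < C t := by
      intro t ht
      by_contra! hle
      obtain ⟨s, hs, hCs⟩ := intermediate_value_Icc' (mem_Ici.1 ht)
        (hCc.mono Icc_subset_Ici_self) ⟨hle, by rw [hC0]; exact hlam1.le⟩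
      have := hfi s hs.1
      rw [hCs] at this
      linarith [hD h]
    obtain ⟨L, hL⟩ := hanti.exists_tendsto_atTop_of_le (fun t ht => (hgt t ht).le)
    have hLe : ∀ t ∈ Ici t₀, L ≤ C t := fun t ht => le_of_tendsto hL <| by
      filter_upwards [eventually_ge_atTop t] with s hs
      exact hanti ht (mem_Ici.2 (le_trans ht hs)) hs
    have hL1 : L ≤ 1 := hC0 ▸ hLe t₀ self_mem_Ici
    have hlamL : lam ≤ L := ge_of_tendsto hL <| by
      filter_upwards [eventually_ge_atTop t₀] with s hs using (hgt s hs).le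
    have hLpos : 0 < L := by linarith
    have hlim : l * log L + (1 - l) * log (L - lam / l) ≤ (1 - l) * log (1 - lam / l) + D := by
      refine le_of_tendsto (((hL.log hLpos.ne').const_mul l).add
        (((hL.sub_const (lam / l)).log (by linarith)).const_mul (1 - l))) ?_
      filter_upwards [eventually_ge_atTop t₀] with s hs using hfi s hs
    have hneq : lam ≠ L := by
      rintro rfl
      linarith [hD h]
    exact ⟨L - lam, sub_pos.2 (lt_of_le_of_ne hlamL hneq), fun t ht => by linarith [hLe t ht],
      L, hL⟩

end Reduced

theorem antitoneOn_log_sub_mul_log_sub {l : ℝ} (hl : 0 < l) :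
    AntitoneOn (fun x => log x - (1 - l) * log (x - l)) (Ioc l 1) := by
  have hd : ∀ x ∈ Ioc l 1, HasDerivAt (fun x => log x - (1 - l) * log (x - l))
      (1 / x - (1 - l) * (1 / (x - l))) x := fun x hx =>
    ((hasDerivAt_id x).log (hl.trans hx.1).ne').sub
      ((((hasDerivAt_id x).sub_const l).log (sub_pos.2 hx.1).ne').const_mul (1 - l))
  refine antitoneOn_of_hasDerivWithinAt_nonpos (convex_Ioc l 1)
    (fun x hx => (hd x hx).continuousAt.continuousWithinAt)
    (fun x hx => (hd x (interior_subset hx)).hasDerivWithinAt) fun x hx => ?_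
  have hx := interior_subset hx
  have h0 : 0 < x := hl.trans hx.1
  have h1 : 0 < x - l := sub_pos.2 hx.1
  rw [mul_one_div, sub_nonpos, div_le_div_iff₀ h0 h1]
  nlinarith [hx.2]

/-- Below the threshold `tl`, the first integral separates the initial velocity `1` from `lam`. -/
theorem log_barrier {l k tl lam a₀ : ℝ} (hl : 0 < l) (hl1 : l < 1) (hk : 0 < k) (htl0 : l < tl)
    (htl1 : tl < 1) (htl : tl * ((1 - l) / (tl - l)) ^ (1 - l) = (2 : ℝ) ^ k)
    (hlam : l < lam) (hlam1 : lam ≤ tl) (ha₀ : 1 < a₀) :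
    (1 - l) * log (1 - lam / l) + k * (log 2 - log a₀) <
      l * log lam + (1 - l) * log (lam - lam / l) := by
  have h1l : 0 < 1 - l := by linarith
  have htll : 0 < tl - l := by linarith
  have hll : 0 < lam - l := by linarith
  have hlam0 : 0 < lam := hl.trans hlam
  have hlog := congrArg log htl
  rw [log_mul (by linarith) (rpow_pos_of_pos (div_pos h1l htll) _).ne',
    log_rpow (div_pos h1l htll), log_rpow two_pos, log_div h1l.ne' htll.ne'] at hlog
  have hanti := antitoneOn_log_sub_mul_log_sub hl ⟨hlam, by linarith⟩ ⟨htl0, htl1.le⟩ hlam1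
  simp only at hanti
  have e1 : log (1 - lam / l) = log (lam - l) - log l := by
    rw [← log_div hll.ne' hl.ne', ← log_neg_eq_log]
    congr 1
    field_simp
    ring
  have e2 : log (lam - lam / l) = log lam + log (1 - l) - log l := by
    rw [← log_mul hlam0.ne' h1l.ne', ← log_div (by positivity) hl.ne', ← log_neg_eq_log]
    congr 1
    field_simp
    ring
  rw [e1, e2]
  nlinarith [mul_pos hk (log_pos ha₀)]

/-- for `0 ≤ λ ≤ λ̃` the solution of the soliton ODE system satisfies
`lim_{t→+∞} C(t) > λ` and `lim_{t→+∞} P(t) = +∞`. -/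
theorem statement13 (m : ℕ) (hm : m = 2 ∨ m = 3 ∨ m = 4)
    (a : ℝ → ℝ) (ha : Admissible a)
    (tl : ℝ) (htl0 : lam0 m < tl) (htl1 : tl < 1)
    (htl : tl * ((1 - lam0 m) / (tl - lam0 m)) ^ (1 - lam0 m)
      = (2 : ℝ) ^ ((4 : ℝ) / ((m : ℝ) + 3))) :
    ∃ ε₀ : ℝ, 0 < ε₀ ∧ ∀ eps : ℝ, 0 < eps → eps < ε₀ →
      ∀ lam : ℝ, 0 ≤ lam → lam ≤ tl →
        ∀ C P : ℝ → ℝ, IsSolODE m lam a eps C P →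
          (∃ L : ℝ, lam < L ∧ Tendsto C atTop (nhds L)) ∧
          Tendsto P atTop atTop := by
  have hl : 0 < lam0 m ∧ lam0 m < 1 := by
    rcases hm with rfl | rfl | rfl <;> norm_num [lam0]
  obtain ⟨hl0, hl1⟩ := hl
  set k : ℝ := 4 / ((m : ℝ) + 3) with hkdef
  have hk : 0 < k := by positivity
  obtain ⟨hsmooth, -, -, -, -, hab, -⟩ := ha
  have hcd : Continuous (deriv a) := hsmooth.continuous_deriv (by norm_num)
  have hdiff : Differentiable ℝ a := hsmooth.differentiable (by norm_num)
  have hapos : ∀ r, 0 < a r := fun r => by linarith [(hab r).1]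
  refine ⟨1, one_pos, fun eps heps _ lam _ hlam1 C P ⟨hode, hC0, _⟩ => ?_⟩
  set t₀ := -Teps lam eps
  have hPc : ContinuousOn P (Ici t₀) := fun t ht => (hode t ht).2.continuousWithinAt
  have hA : ∀ t ∈ Ici t₀, HasDerivWithinAt (fun t => k * log (a (eps * P t)))
      (eps * k * (deriv a (eps * P t) / a (eps * P t)) * (C t - lam)) (Ici t₀) t := by
    intro t ht
    have h := ((((hdiff (eps * P t)).hasDerivAt.comp_hasDerivWithinAt t
      ((hode t ht).2.const_mul eps)).log (hapos _).ne').const_mul k)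
    refine h.congr_deriv ?_
    simp only [Function.comp_apply]
    ring
  obtain ⟨δ, hδ, hle, L, hL⟩ := reduced_system_converges (l := lam0 m) (lam := lam) (t₀ := t₀)
    (D := k * (log 2 - log (a (eps * P t₀))))
    (b := fun t => eps * k * (deriv a (eps * P t) / a (eps * P t)))
    hl0 hl1 (by linarith) hC0
    (fun t ht => (hode t ht).1.congr_deriv (by rw [f1]; ring))
    (continuousOn_const.mul <|
      (hcd.comp_continuousOn (continuousOn_const.mul hPc)).div
        (hdiff.continuous.comp_continuousOn (continuousOn_const.mul hPc))
        fun t _ => (hapos _).ne')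
    (fun t _ => mul_nonneg (by positivity) (div_nonneg (hab _).2.2.le (hapos _).le))
    hA
    (fun t _ => by
      have := log_le_log (hapos (eps * P t)) (hab (eps * P t)).2.1.le
      rw [← mul_sub]
      gcongr)
    (fun h => log_barrier hl0 hl1 hk htl0 htl1 htl h hlam1 (hab _).1)
  refine ⟨⟨L, ?_, hL⟩, tendsto_atTop_of_le_hasDerivWithinAt hδ (fun t ht => (hode t ht).2) hle⟩
  have : lam + δ ≤ L := ge_of_tendsto hL <| by
    filter_upwards [eventually_ge_atTop t₀] with t ht
    linarith [hle t ht]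
  linarith
end

section
/- Let m ∈ {2,3,4}, let a be an admissible potential, and let λ̃ ∈ (λ₀,1) be the unique solution of λ̃((1−λ₀)/(λ̃−λ₀))^{1−λ₀} = 2^{4/(m+3)}. Fix λ with λ̃ < λ < 1. There exist a constant K(λ) > 0 and ε₀ > 0 such that for all 0 < ε < ε₀ the solution (C,P) on [−T_ε, +∞) of the soliton ODE system C' = ε f₁(C,P), P' = C − λ, C(−T_ε) = 1, P(−T_ε) = −(1−λ)T_ε satisfies: there is a unique t₀ ∈ (−T_ε, +∞) with C(t₀) = λ; moreover −T_ε < t₀ ≤ K(λ)·T_ε, lim_{t→+∞} C(t) < λ, and lim_{t→+∞} P(t) = −∞. -/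
open Real Filter Set

/-- A solution of `y' = h y` which is positive initially stays positive. -/
lemma pos_of_linear_ode {s : ℝ} {h y : ℝ → ℝ} (hh : ContinuousOn h (Ici s))
    (hy : ∀ t ∈ Ici s, HasDerivWithinAt y (h t * y t) (Ici s) t) (hs : 0 < y s) :
    ∀ t ∈ Ici s, 0 < y t := by
  intro t ht
  set k : ℝ → ℝ := fun x => h (max x s) with hk
  have hkc : Continuous k :=
    hh.comp_continuous (by fun_prop) (fun x => le_max_right x s)
  have hG : ∀ x, HasDerivAt (fun u => ∫ v in s..u, k v) (k x) x := fun x =>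
    intervalIntegral.integral_hasDerivAt_right (hkc.intervalIntegrable _ _)
      (hkc.stronglyMeasurableAtFilter _ _) hkc.continuousAt
  have hF : ∀ x ∈ Ici s,
      HasDerivWithinAt (fun u => y u * exp (-∫ v in s..u, k v)) 0 (Ici s) x := by
    intro x hx
    have hkx : k x = h x := by simp only [hk, max_eq_left (mem_Ici.1 hx)]
    have := (hy x hx).mul (hG x).neg.exp.hasDerivWithinAt
    refine this.congr_deriv ?_
    simp only [Pi.neg_apply]
    rw [hkx]
    ring
  have := constant_of_has_deriv_right_zero (a := s) (b := t)
    (f := fun u => y u * exp (-∫ v in s..u, k v))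
    (fun x hx => ((hF x hx.1).continuousWithinAt).mono Icc_subset_Ici_self)
    (fun x hx => (hF x hx.1).mono (Ici_subset_Ici.2 hx.1)) t ⟨ht, le_rfl⟩
  simp only [intervalIntegral.integral_same, neg_zero, exp_zero, mul_one] at this
  have h2 : 0 < y t * exp (-∫ v in s..t, k v) := by rw [this]; exact hs
  exact pos_of_mul_pos_left h2 (exp_pos _).le

/-- The function `H` for which `H(C) - (4/(m+3)) log a(εP)` is conserved along the flow. -/
noncomputable def scalingEnergy (l lam c : ℝ) : ℝ := l * log c + (1 - l) * log (lam / l - c)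

lemma scalingEnergy_strictAntiOn {l lam : ℝ} (hl : 0 < l) (hlam : l < lam) :
    StrictAntiOn (scalingEnergy l lam) (Icc lam 1) := by
  have h1 : 1 < lam / l := (one_lt_div hl).2 hlam
  have hd : ∀ c ∈ Icc lam 1, HasDerivAt (scalingEnergy l lam)
      (l * c⁻¹ + (1 - l) * (-1 / (lam / l - c))) c := by
    intro c hc
    have hc0 : c ≠ 0 := by linarith [hc.1]
    have hc1 : lam / l - c ≠ 0 := by linarith [hc.2]
    exact ((hasDerivAt_log hc0).const_mul l).add
      ((((hasDerivAt_id c).const_sub (lam / l)).log hc1).const_mul (1 - l))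
  refine strictAntiOn_of_deriv_neg (convex_Icc _ _)
    (fun c hc => (hd c hc).continuousAt.continuousWithinAt) ?_
  intro c hc
  have hc' := interior_subset hc
  rw [interior_Icc] at hc
  rw [(hd c hc').deriv]
  have hc0 : 0 < c := by linarith [hc.1]
  have hc1 : 0 < lam / l - c := by linarith [hc.2]
  have : l * c⁻¹ + (1 - l) * (-1 / (lam / l - c)) = (lam - c) / (c * (lam / l - c)) := by
    rw [inv_eq_one_div, mul_div_assoc', mul_div_assoc', div_add_div _ _ hc0.ne' hc1.ne']
    congr 1
    field_simp
    ring
  rw [this]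
  exact div_neg_of_neg_of_pos (by linarith [hc.1]) (by positivity)

lemma log_sub_mul_log_strictAntiOn {l : ℝ} (hl : 0 < l) :
    StrictAntiOn (fun x => log x - (1 - l) * log (x - l)) (Ioc l 1) := by
  have hd : ∀ x ∈ Ioc l 1, HasDerivAt (fun x => log x - (1 - l) * log (x - l))
      (x⁻¹ - (1 - l) * (1 / (x - l))) x := by
    intro x hx
    have hx0 : x ≠ 0 := by linarith [hx.1]
    have hx1 : x - l ≠ 0 := by linarith [hx.1]
    exact (hasDerivAt_log hx0).sub ((((hasDerivAt_id x).sub_const l).log hx1).const_mul (1 - l))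
  refine strictAntiOn_of_deriv_neg (convex_Ioc _ _)
    (fun c hc => (hd c hc).continuousAt.continuousWithinAt) ?_
  intro x hx
  have hx' := interior_subset hx
  rw [interior_Ioc] at hx
  rw [(hd x hx').deriv]
  have hx0 : 0 < x := by linarith [hx.1]
  have hx1 : 0 < x - l := by linarith [hx.1]
  have : x⁻¹ - (1 - l) * (1 / (x - l)) = -(l * (1 - x)) / (x * (x - l)) := by
    field_simp
    ring
  rw [this]
  exact div_neg_of_neg_of_pos (by nlinarith [hx.2]) (by positivity)

/-- Above the threshold `tl`, the energy gap between `1` and `lam` is smaller than `κ log 2`. -/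
lemma scalingEnergy_gap_lt {l lam tl κ : ℝ} (hl : 0 < l) (hl1 : l < 1) (htl0 : l < tl)
    (htl1 : tl < 1) (htl : tl * ((1 - l) / (tl - l)) ^ (1 - l) = (2 : ℝ) ^ κ)
    (hlam0 : tl < lam) (hlam1 : lam < 1) :
    scalingEnergy l lam lam - scalingEnergy l lam 1 < κ * log 2 := by
  have h1 : 0 < tl - l := by linarith
  have h2 : 0 < 1 - l := by linarith
  have h3 : 0 < tl := by linarith
  have h4 : 0 < lam - l := by linarith
  have h5 : 0 < lam := by linarith
  have hlog := congrArg log htl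
  rw [log_mul h3.ne' (by positivity), log_rpow (by positivity), log_rpow (by norm_num),
    log_div h2.ne' h1.ne'] at hlog
  have hanti := log_sub_mul_log_strictAntiOn hl ⟨htl0, htl1.le⟩ ⟨htl0.trans hlam0, hlam1.le⟩ hlam0
  simp only at hanti
  have e1 : lam / l - lam = lam * (1 - l) / l := by field_simp
  have e2 : lam / l - 1 = (lam - l) / l := by field_simp
  unfold scalingEnergy
  rw [e1, e2, log_div (by positivity) hl.ne', log_div h4.ne' hl.ne', log_mul h5.ne' h2.ne',
    log_one]
  linarith

namespace Admissible

variable {a : ℝ → ℝ}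

lemma one_lt (ha : Admissible a) (r : ℝ) : 1 < a r := by
  obtain ⟨_, K, γ, _, _, h, _⟩ := ha
  exact (h r).1

lemma lt_two (ha : Admissible a) (r : ℝ) : a r < 2 := by
  obtain ⟨_, K, γ, _, _, h, _⟩ := ha
  exact (h r).2.1

lemma deriv_pos (ha : Admissible a) (r : ℝ) : 0 < deriv a r := by
  obtain ⟨_, K, γ, _, _, h, _⟩ := ha
  exact (h r).2.2

lemma pos (ha : Admissible a) (r : ℝ) : 0 < a r := one_pos.trans (ha.one_lt r)

lemma hasDerivAt (ha : Admissible a) (r : ℝ) : HasDerivAt a (deriv a r) r :=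
  (ha.1.differentiable (by norm_num) r).hasDerivAt

lemma continuous (ha : Admissible a) : Continuous a := ha.1.continuous

lemma continuous_deriv (ha : Admissible a) : Continuous (deriv a) :=
  ha.1.continuous_deriv (by norm_num)

lemma strictMono (ha : Admissible a) : StrictMono a :=
  strictMono_of_deriv_pos ha.deriv_pos

lemma tendsto_atBot (ha : Admissible a) : Tendsto a atBot (nhds 1) := by
  have ha' := ha
  obtain ⟨_, K, γ, _, hγ, _, h, _⟩ := ha'
  have hlim : Tendsto (fun r => 1 + K * exp (γ * r)) atBot (nhds (1 + K * 0)) :=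
    ((tendsto_exp_atBot.comp (tendsto_id.const_mul_atBot hγ)).const_mul K).const_add 1
  rw [mul_zero, add_zero] at hlim
  refine tendsto_of_tendsto_of_tendsto_of_le_of_le' tendsto_const_nhds hlim
    (Eventually.of_forall fun r => (ha.one_lt r).le) ?_
  filter_upwards [eventually_le_atBot 0] with r hr
  linarith [h r hr]

lemma tendsto_atTop (ha : Admissible a) : Tendsto a atTop (nhds 2) := by
  have ha' := ha
  obtain ⟨_, K, γ, _, hγ, _, _, h, _⟩ := ha'
  have hlim : Tendsto (fun r => 2 - K * exp (-γ * r)) atTop (nhds (2 - K * 0)) :=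
    ((tendsto_exp_atBot.comp
      (tendsto_id.const_mul_atTop_of_neg (neg_neg_of_pos hγ))).const_mul K).const_sub 2
  rw [mul_zero, sub_zero] at hlim
  refine tendsto_of_tendsto_of_tendsto_of_le_of_le' hlim tendsto_const_nhds ?_
    (Eventually.of_forall fun r => (ha.lt_two r).le)
  filter_upwards [eventually_ge_atTop 0] with r hr
  linarith [h r hr]

lemma exists_deriv_lower_bound (ha : Admissible a) (M R : ℝ) :
    ∃ c > 0, ∀ r ∈ Icc M R, c ≤ deriv a r := by
  rcases (Icc M R).eq_empty_or_nonempty with h | h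
  · exact ⟨1, one_pos, by simp [h]⟩
  · obtain ⟨x, _, hx⟩ := isCompact_Icc.exists_isMinOn h ha.continuous_deriv.continuousOn
    exact ⟨deriv a x, ha.deriv_pos x, fun r hr => hx hr⟩

end Admissible

namespace IsSolODE

variable {m : ℕ} {lam eps : ℝ} {a C P : ℝ → ℝ}

lemma continuousOn_fst (h : IsSolODE m lam a eps C P) : ContinuousOn C (Ici (-Teps lam eps)) :=
  fun t ht => (h.1 t ht).1.continuousWithinAt

lemma continuousOn_snd (h : IsSolODE m lam a eps C P) : ContinuousOn P (Ici (-Teps lam eps)) :=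
  fun t ht => (h.1 t ht).2.continuousWithinAt

lemma continuousOn_logDeriv (h : IsSolODE m lam a eps C P) (ha : Admissible a) :
    ContinuousOn (fun t => deriv a (eps * P t) / a (eps * P t)) (Ici (-Teps lam eps)) := by
  have hP : ContinuousOn (fun t => eps * P t) (Ici (-Teps lam eps)) :=
    h.continuousOn_snd.const_mul eps
  exact (ha.continuous_deriv.comp_continuousOn hP).div (ha.continuous.comp_continuousOn hP)
    (fun t _ => (ha.pos _).ne')

lemma fst_pos (h : IsSolODE m lam a eps C P) (ha : Admissible a) :
    ∀ t ∈ Ici (-Teps lam eps), 0 < C t := by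
  refine pos_of_linear_ode (h := fun t => eps * (4 / ((m : ℝ) + 3)) * (C t - lam / lam0 m) *
    (deriv a (eps * P t) / a (eps * P t))) ?_ ?_ (by rw [h.2.1]; exact one_pos)
  · exact (continuousOn_const.mul (h.continuousOn_fst.sub continuousOn_const)).mul
      (h.continuousOn_logDeriv ha)
  · intro t ht
    refine (h.1 t ht).1.congr_deriv ?_
    unfold f1
    ring

lemma fst_lt (h : IsSolODE m lam a eps C P) (ha : Admissible a) (hlam : 1 < lam / lam0 m) :
    ∀ t ∈ Ici (-Teps lam eps), C t < lam / lam0 m := by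
  have := pos_of_linear_ode (y := fun t => lam / lam0 m - C t)
    (h := fun t => eps * (4 / ((m : ℝ) + 3)) * C t *
      (deriv a (eps * P t) / a (eps * P t))) (s := -Teps lam eps) ?_ ?_
      (by rw [h.2.1]; linarith)
  · exact fun t ht => sub_pos.1 (this t ht)
  · exact (continuousOn_const.mul h.continuousOn_fst).mul (h.continuousOn_logDeriv ha)
  · intro t ht
    refine ((h.1 t ht).1.const_sub (lam / lam0 m)).congr_deriv ?_
    unfold f1
    ring

lemma strictAntiOn_fst (h : IsSolODE m lam a eps C P) (ha : Admissible a)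
    (hlam : 1 < lam / lam0 m) (heps : 0 < eps) : StrictAntiOn C (Ici (-Teps lam eps)) := by
  refine strictAntiOn_of_deriv_neg (convex_Ici _) h.continuousOn_fst ?_
  intro t ht
  rw [interior_Ici] at ht
  have ht' : t ∈ Ici (-Teps lam eps) := Ioi_subset_Ici_self ht
  rw [((h.1 t ht').1.hasDerivAt (Ici_mem_nhds ht)).deriv]
  have h1 := h.fst_pos ha t ht'
  have h2 := h.fst_lt ha hlam t ht'
  have h3 := ha.deriv_pos (eps * P t)
  have h4 := ha.pos (eps * P t)
  have : 0 < eps * (4 / ((m : ℝ) + 3) * C t * (lam / lam0 m - C t) *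
      deriv a (eps * P t) / a (eps * P t)) := by
    have := sub_pos.2 h2
    positivity
  unfold f1
  linear_combination this

lemma energy_eq (h : IsSolODE m lam a eps C P) (ha : Admissible a)
    (hl : 0 < lam0 m) (hlam : 1 < lam / lam0 m) {t : ℝ} (ht : -Teps lam eps ≤ t) :
    scalingEnergy (lam0 m) lam (C t) - 4 / ((m : ℝ) + 3) * log (a (eps * P t)) =
      scalingEnergy (lam0 m) lam 1 -
        4 / ((m : ℝ) + 3) * log (a (eps * -((1 - lam) * Teps lam eps))) := by
  have hd : ∀ x ∈ Ici (-Teps lam eps), HasDerivWithinAt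
      (fun t => scalingEnergy (lam0 m) lam (C t) - 4 / ((m : ℝ) + 3) * log (a (eps * P t)))
      0 (Ici (-Teps lam eps)) x := by
    intro x hx
    have h1 := h.fst_pos ha x hx
    have h2 := sub_pos.2 (h.fst_lt ha hlam x hx)
    have h4 := ha.pos (eps * P x)
    obtain ⟨dC, dP⟩ := h.1 x hx
    have hmain := (((dC.log h1.ne').const_mul (lam0 m)).add
      (((dC.const_sub (lam / lam0 m)).log h2.ne').const_mul (1 - lam0 m))).sub
      ((((ha.hasDerivAt (eps * P x)).comp_hasDerivWithinAt x (dP.const_mul eps)).log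
        h4.ne').const_mul (4 / ((m : ℝ) + 3)))
    refine hmain.congr_deriv ?_
    unfold f1
    have h5 : C x - lam / lam0 m ≠ 0 := by linarith
    have e : -(eps * (4 / ((m : ℝ) + 3) * C x * (C x - lam / lam0 m) * deriv a (eps * P x) /
        a (eps * P x))) / (lam / lam0 m - C x) =
        eps * (4 / ((m : ℝ) + 3) * C x * deriv a (eps * P x) / a (eps * P x)) := by
      rw [div_eq_iff h2.ne']
      ring
    rw [e]
    simp only [Function.comp_apply]
    field_simp
    ring
  have := constant_of_has_deriv_right_zero (a := -Teps lam eps) (b := t)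
    (fun x hx => ((hd x hx.1).continuousWithinAt).mono Icc_subset_Ici_self)
    (fun x hx => (hd x hx.1).mono (Ici_subset_Ici.2 hx.1)) t ⟨ht, le_rfl⟩
  simpa only [h.2.1, h.2.2] using this

end IsSolODE

/-- If the derivative of `f` is at most `c` on `[s, t]`, then `f t ≤ f s + c (t - s)`. -/
lemma le_add_mul_of_hasDerivWithinAt_le {u s t c : ℝ} {f f' : ℝ → ℝ} (hus : u ≤ s) (hst : s ≤ t)
    (hf : ∀ x ∈ Ici u, HasDerivWithinAt f (f' x) (Ici u) x) (hc : ∀ x ∈ Icc s t, f' x ≤ c) :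
    f t ≤ f s + c * (t - s) := by
  have hB : ∀ x, HasDerivAt (fun x => f s + c * (x - s)) c x := fun x => by
    simpa using (((hasDerivAt_id x).sub_const s).const_mul c).const_add (f s)
  exact image_le_of_deriv_right_le_deriv_boundary (a := s) (b := t) (f := f) (f' := f')
    (fun x hx => ((hf x (hus.trans hx.1)).continuousWithinAt).mono
      (fun y hy => hus.trans hy.1))
    (fun x hx => (hf x (hus.trans hx.1)).mono (Ici_subset_Ici.2 (hus.trans hx.1)))
    (by simp) (fun x _ => (hB x).continuousAt.continuousWithinAt)
    (fun x _ => (hB x).hasDerivWithinAt) (fun x hx => hc x (Ico_subset_Icc_self hx)) ⟨hst, le_rfl⟩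

/-- The rescaled initial position `-(1-λ)εT_ε = -ε^{-1/100}` tends to `-∞` as `ε → 0⁺`. -/
lemma tendsto_rescaled_initial_position {lam : ℝ} (hlam : lam < 1) :
    Tendsto (fun eps => eps * -((1 - lam) * Teps lam eps)) (nhdsWithin 0 (Ioi 0)) atBot := by
  have h := tendsto_neg_atTop_atBot.comp
    (tendsto_rpow_neg_nhdsGT_zero (y := -(1 / 100)) (by norm_num))
  refine h.congr' ?_
  filter_upwards [self_mem_nhdsWithin] with eps heps
  have heps : 0 < eps := heps
  have h1 : 1 - lam ≠ 0 := by linarith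
  unfold Teps
  rw [mul_div_cancel₀ _ h1, Function.comp_apply, mul_neg, show -(1 : ℝ) - 1 / 100 = -1 + -(1 / 100) by ring,
    rpow_add heps, rpow_neg_one, mul_inv_cancel_left₀ heps.ne']

lemma one_le_mul_Teps {lam eps : ℝ} (hlam : 0 < lam) (hlam1 : lam < 1) (heps : 0 < eps)
    (heps1 : eps < 1) : 1 ≤ eps * Teps lam eps := by
  have h1 : 0 < 1 - lam := by linarith
  have h2 : eps⁻¹ ≤ eps ^ (-(1 : ℝ) - 1 / 100) := by
    rw [← rpow_neg_one]
    exact rpow_le_rpow_of_exponent_ge heps heps1.le (by norm_num)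
  have h3 : 1 ≤ eps * eps ^ (-(1 : ℝ) - 1 / 100) := by
    have := mul_le_mul_of_nonneg_left h2 heps.le
    rwa [mul_inv_cancel₀ heps.ne'] at this
  unfold Teps
  rw [← mul_div_assoc, le_div_iff₀ h1]
  linarith

namespace IsSolODE

variable {m : ℕ} {lam eps : ℝ} {a C P : ℝ → ℝ}

/-- `C` falls to `lam` within a fixed multiple of `T_ε`. Hypothesis `hM` says that `εP` is above
`M` once `C` is below `(1 + lam) / 2`, and `hR` that `εP` stays below `R` while `C ≥ lam`. -/
lemma le_at_multiple_Teps (h : IsSolODE m lam a eps C P) (ha : Admissible a)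
    (hl : 0 < lam0 m) (hlam0 : lam0 m < lam) (hlam1 : lam < 1) (heps : 0 < eps)
    (hT : 1 ≤ eps * Teps lam eps) {M R c : ℝ} (hc : 0 < c) (hM0 : M ≤ 0)
    (hM : 4 / ((m : ℝ) + 3) * log (a M) <
      scalingEnergy (lam0 m) lam ((1 + lam) / 2) - scalingEnergy (lam0 m) lam 1)
    (hR : scalingEnergy (lam0 m) lam lam - scalingEnergy (lam0 m) lam 1 +
      4 / ((m : ℝ) + 3) * log (a (eps * -((1 - lam) * Teps lam eps))) <
        4 / ((m : ℝ) + 3) * log (a R))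
    (hder : ∀ r ∈ Icc M R, c ≤ deriv a r) :
    C ((1 + 1 / (4 / ((m : ℝ) + 3) * lam * (lam / lam0 m - 1) * c / 2)) * Teps lam eps)
      ≤ lam := by
  set T := Teps lam eps with hTdef
  set κ := 4 / ((m : ℝ) + 3) with hκ
  have hκ0 : 0 < κ := by positivity
  have hlam : 0 < lam := hl.trans hlam0
  have hq : 1 < lam / lam0 m := (one_lt_div hl).2 hlam0
  have hq' : 0 < lam / lam0 m - 1 := sub_pos.2 hq
  set c0 := κ * lam * (lam / lam0 m - 1) * c / 2 with hc0
  have hc0pos : 0 < c0 := by positivity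
  have hTpos : 0 < T := pos_of_mul_pos_right (one_pos.trans_le hT) heps.le
  set τ := (1 + 1 / c0) * T with hτ
  have hτT : T ≤ τ := by
    have : 0 < 1 / c0 * T := by positivity
    linarith
  by_contra! hcon
  have hanti := h.strictAntiOn_fst ha hq heps
  have hCgt : ∀ t, -T ≤ t → t ≤ τ → lam < C t := fun t h1 h2 =>
    hcon.trans_le (hanti.antitoneOn h1 (h1.trans h2) h2)
  have hCle : ∀ t, -T ≤ t → C t ≤ 1 := fun t h1 =>
    (hanti.antitoneOn self_mem_Ici h1 h1).trans_eq h.2.1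
  have hH := scalingEnergy_strictAntiOn hl hlam0
  have hlogmono : ∀ {x y : ℝ}, x ≤ y → κ * log (a x) ≤ κ * log (a y) := fun hxy =>
    mul_le_mul_of_nonneg_left (log_le_log (ha.pos _) (ha.strictMono.monotone hxy)) hκ0.le
  have hP' : ∀ x ∈ Ici (-T), HasDerivWithinAt (fun t => -P t) (-(C x - lam)) (Ici (-T)) x :=
    fun x hx => (h.1 x hx).2.neg
  have hMP : M ≤ eps * P T := by
    rcases le_or_gt ((1 + lam) / 2) (C T) with hC | hC
    · have hb := le_add_mul_of_hasDerivWithinAt_le (u := -T) (s := -T) (t := T)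
        (c := -((1 - lam) / 2)) le_rfl (by linarith) hP' (fun x hx => by
          have := hanti.antitoneOn hx.1 (show -T ≤ T by linarith) hx.2
          linarith)
      rw [h.2.2] at hb
      have : 0 ≤ P T := by linarith
      exact hM0.trans (mul_nonneg heps.le this)
    · by_contra! hlt
      have he := h.energy_eq ha hl hq (t := T) (by linarith)
      have h1 := hH ⟨(hCgt T (by linarith) hτT).le, hCle T (by linarith)⟩
        ⟨by linarith, by linarith⟩ hC
      have h2 := hlogmono hlt.le
      have h3 : 0 < κ * log (a (eps * -((1 - lam) * T))) :=
        mul_pos hκ0 (log_pos (ha.one_lt _))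
      linarith
  have hPR : ∀ t ∈ Icc T τ, eps * P t ∈ Icc M R := by
    intro t ht
    have htT : -T ≤ t := by linarith [ht.1]
    constructor
    · have hb := le_add_mul_of_hasDerivWithinAt_le (u := -T) (s := T) (t := t)
        (c := 0) (by linarith) ht.1 hP' (fun x hx => by
          have := hCgt x (by linarith [hx.1]) (hx.2.trans ht.2)
          linarith)
      exact hMP.trans (mul_le_mul_of_nonneg_left (by linarith) heps.le)
    · by_contra! hlt
      have he := h.energy_eq ha hl hq htT
      have h1 := hH ⟨le_rfl, hlam1.le⟩ ⟨(hCgt t htT ht.2).le, hCle t htT⟩ (hCgt t htT ht.2)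
      have h2 := hlogmono hlt.le
      linarith
  have hb := le_add_mul_of_hasDerivWithinAt_le (u := -T) (s := T) (t := τ)
    (c := -(eps * c0)) (by linarith) hτT (fun x hx => (h.1 x hx).1) (fun x hx => by
      have hxT : -T ≤ x := by linarith [hx.1]
      have h1 := hCgt x hxT hx.2
      have h2 := hCle x hxT
      have h3 := hder _ (hPR x hx)
      have h4 := ha.lt_two (eps * P x)
      have h5 := ha.pos (eps * P x)
      have h6 : c0 ≤ κ * C x * (lam / lam0 m - C x) * deriv a (eps * P x) / a (eps * P x) := by
        have h7 : 0 < lam / lam0 m - C x := by linarith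
        have h8 := ha.deriv_pos (eps * P x)
        have h9 := hlam.trans h1
        rw [hc0]
        gcongr
      unfold f1
      have h10 := mul_le_mul_of_nonneg_left h6 heps.le
      rw [← hκ]
      calc _ = -(eps * (κ * C x * (lam / lam0 m - C x) * deriv a (eps * P x) /
                a (eps * P x))) := by ring
        _ ≤ _ := neg_le_neg h10)
  have h1 : -(eps * c0) * (τ - T) = -(eps * T) := by
    rw [hτ]
    field_simp
    ring
  have h2 := hCle T (by linarith)
  linarith

/-- After `C` crosses `lam`, it converges to a limit below `lam` and `P` escapes to `-∞`. -/
lemma tendsto_of_crossing (h : IsSolODE m lam a eps C P) (ha : Admissible a)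
    (hlam : 1 < lam / lam0 m) (heps : 0 < eps) {t0 : ℝ} (ht0 : -Teps lam eps ≤ t0)
    (hC : C t0 = lam) :
    (∃ L : ℝ, L < lam ∧ Tendsto C atTop (nhds L)) ∧ Tendsto P atTop atBot := by
  have hanti := h.strictAntiOn_fst ha hlam heps
  have ht1 : -Teps lam eps ≤ t0 + 1 := by linarith
  have hC1 : C (t0 + 1) < lam := hC ▸ hanti ht0 ht1 (by linarith)
  have hCle : ∀ t, t0 + 1 ≤ t → C t ≤ C (t0 + 1) := fun t ht =>
    hanti.antitoneOn ht1 (ht1.trans ht) ht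
  constructor
  · have hmono : Antitone fun t => C (max t (-Teps lam eps)) := fun x y hxy =>
      hanti.antitoneOn (mem_Ici.2 (le_max_right _ _)) (mem_Ici.2 (le_max_right _ _))
        (max_le_max_right _ hxy)
    have hbdd : BddBelow (range fun t => C (max t (-Teps lam eps))) :=
      ⟨0, by rintro _ ⟨t, rfl⟩; exact (h.fst_pos ha _ (mem_Ici.2 (le_max_right _ _))).le⟩
    have hlim : Tendsto C atTop (nhds (⨅ t, C (max t (-Teps lam eps)))) := by
      refine (tendsto_atTop_ciInf hmono hbdd).congr' ?_
      filter_upwards [eventually_ge_atTop (-Teps lam eps)] with t ht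
      rw [max_eq_left ht]
    refine ⟨_, (le_of_tendsto hlim ?_).trans_lt hC1, hlim⟩
    filter_upwards [eventually_ge_atTop (t0 + 1)] with t ht using hCle t ht
  · have hlin : Tendsto (fun t => P (t0 + 1) + (C (t0 + 1) - lam) * (t - (t0 + 1))) atTop atBot :=
      tendsto_atBot_add_const_left _ _ ((tendsto_atTop_add_const_right _ _
        tendsto_id).const_mul_atTop_of_neg (sub_neg.2 hC1))
    refine tendsto_atBot_mono' _ ?_ hlin
    filter_upwards [eventually_ge_atTop (t0 + 1)] with t ht
    exact le_add_mul_of_hasDerivWithinAt_le ht1 ht (fun x hx => (h.1 x hx).2)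
      (fun x hx => by linarith [hCle x hx.1])

end IsSolODE

/-- for `λ̃ < λ < 1`, the scaling `C` crosses the value `λ` exactly once,
at a time `t₀ ∈ (-T_ε, K(λ) T_ε]`; moreover `lim_{t→+∞} C(t) < λ` and
`lim_{t→+∞} P(t) = -∞`. -/
theorem statement14 (m : ℕ) (hm : m = 2 ∨ m = 3 ∨ m = 4)
    (a : ℝ → ℝ) (ha : Admissible a)
    (tl : ℝ) (htl0 : lam0 m < tl) (htl1 : tl < 1)
    (htl : tl * ((1 - lam0 m) / (tl - lam0 m)) ^ (1 - lam0 m)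
      = (2 : ℝ) ^ ((4 : ℝ) / ((m : ℝ) + 3)))
    (lam : ℝ) (hlam0 : tl < lam) (hlam1 : lam < 1) :
    ∃ Kl ε₀ : ℝ, 0 < Kl ∧ 0 < ε₀ ∧ ∀ eps : ℝ, 0 < eps → eps < ε₀ →
      ∀ C P : ℝ → ℝ, IsSolODE m lam a eps C P →
        (∃! t0 : ℝ, -Teps lam eps < t0 ∧ C t0 = lam) ∧
        (∀ t0 : ℝ, -Teps lam eps < t0 ∧ C t0 = lam → t0 ≤ Kl * Teps lam eps) ∧
        (∃ L : ℝ, L < lam ∧ Tendsto C atTop (nhds L)) ∧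
        Tendsto P atTop atBot := by
  have hl : 0 < lam0 m := by rcases hm with rfl | rfl | rfl <;> norm_num [lam0]
  have hl1 : lam0 m < 1 := htl0.trans htl1
  have hllam : lam0 m < lam := htl0.trans hlam0
  have hlam : 0 < lam := hl.trans hllam
  have hq : 1 < lam / lam0 m := (one_lt_div hl).2 hllam
  have hq' : 0 < lam / lam0 m - 1 := sub_pos.2 hq
  have hgap := scalingEnergy_gap_lt hl hl1 htl0 htl1 htl hlam0 hlam1
  have hmid := scalingEnergy_strictAntiOn hl hllam (a := (1 + lam) / 2) (b := 1)
    ⟨by linarith, by linarith⟩ ⟨hlam1.le, le_rfl⟩ (by linarith)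
  set κ := 4 / ((m : ℝ) + 3) with hκ
  have hκ0 : 0 < κ := by positivity
  set g := scalingEnergy (lam0 m) lam lam - scalingEnergy (lam0 m) lam 1
  have hbot : Tendsto (fun r => κ * log (a r)) atBot (nhds 0) := by
    simpa using (ha.tendsto_atBot.log one_ne_zero).const_mul κ
  have htop : Tendsto (fun r => κ * log (a r)) atTop (nhds (κ * log 2)) :=
    (ha.tendsto_atTop.log two_ne_zero).const_mul κ
  obtain ⟨M, hM0, hM⟩ := ((eventually_le_atBot 0).and
    (hbot.eventually_lt_const (sub_pos.2 hmid))).exists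
  obtain ⟨R, hR⟩ := (htop.eventually_const_lt
    (show (g + κ * log 2) / 2 < κ * log 2 by linarith)).exists
  obtain ⟨c, hc, hder⟩ := ha.exists_deriv_lower_bound M R
  have hsmall := (hbot.comp (tendsto_rescaled_initial_position hlam1)).eventually_lt_const
    (show 0 < (κ * log 2 - g) / 2 by linarith)
  obtain ⟨ε₁, hε₁, hsmall⟩ := mem_nhdsGT_iff_exists_Ioo_subset.1 hsmall
  have hε₁ : 0 < ε₁ := hε₁
  refine ⟨1 + 1 / (κ * lam * (lam / lam0 m - 1) * c / 2), min ε₁ 1, by positivity,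
    lt_min hε₁ one_pos, fun eps heps hlt C P h => ?_⟩
  have hinit : κ * log (a (eps * -((1 - lam) * Teps lam eps))) < (κ * log 2 - g) / 2 :=
    hsmall ⟨heps, hlt.trans_le (min_le_left _ _)⟩
  have hT := one_le_mul_Teps hlam hlam1 heps (hlt.trans_le (min_le_right _ _))
  have hTpos : 0 < Teps lam eps := pos_of_mul_pos_right (one_pos.trans_le hT) heps.le
  have hle := h.le_at_multiple_Teps ha hl hllam hlam1 heps hT hc hM0 hM
    (by rw [← hκ]; linarith) hder
  rw [← hκ] at hle
  set τ := (1 + 1 / (κ * lam * (lam / lam0 m - 1) * c / 2)) * Teps lam eps with hτ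
  have hτ0 : 0 < τ := by positivity
  have hanti := h.strictAntiOn_fst ha hq heps
  obtain ⟨t0, ht0, hCt0⟩ := intermediate_value_Icc' (show -Teps lam eps ≤ τ by linarith)
    (h.continuousOn_fst.mono Icc_subset_Ici_self) ⟨hle, by rw [h.2.1]; exact hlam1.le⟩
  have hne : -Teps lam eps < t0 := lt_of_le_of_ne ht0.1 (by
    rintro rfl
    linarith [h.2.1])
  have huniq : ∀ t, -Teps lam eps < t ∧ C t = lam → t = t0 := fun t ht =>
    hanti.injOn (mem_Ici.2 ht.1.le) (mem_Ici.2 ht0.1) (ht.2.trans hCt0.symm)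
  exact ⟨⟨t0, ⟨hne, hCt0⟩, huniq⟩, fun t ht => huniq t ht ▸ ht0.2,
    h.tendsto_of_crossing ha hq heps ht0.1 hCt0⟩
end

section
/- Let m ∈ {2,3,4}, let a be an admissible potential, let λ̃ be as usual, and fix λ with λ̃ < λ < 1. There exist constants κ > 0 and ε₀ > 0 such that for all 0 < ε < ε₀ the following holds. Let (C,P) be the solution of the soliton ODE system C' = ε f₁(C,P), P' = C − λ, C(−T_ε) = 1, P(−T_ε) = −(1−λ)T_ε, and let T̃_ε > −T_ε be the unique time with P(T̃_ε) = −(1−λ)T_ε. Then ε·∫_{−T_ε}^{T̃_ε} ((C(t) − λ)/C(t)^{1/2}) · (a'(εP(t))²/a(εP(t))²) dt ≤ −κ. -/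
open Real Filter Set

theorem sub_le_sub_of_hasDerivAt_le {f g f' g' : ℝ → ℝ} {x y : ℝ} (hxy : x ≤ y)
    (hf : ContinuousOn f (Icc x y)) (hg : ContinuousOn g (Icc x y))
    (hf' : ∀ t ∈ Ioo x y, HasDerivAt f (f' t) t) (hg' : ∀ t ∈ Ioo x y, HasDerivAt g (g' t) t)
    (hle : ∀ t ∈ Ioo x y, f' t ≤ g' t) : f y - f x ≤ g y - g x := by
  have hmono : MonotoneOn (fun t => g t - f t) (Icc x y) := by
    refine monotoneOn_of_hasDerivWithinAt_nonneg (f' := fun t => g' t - f' t) (convex_Icc x y)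
      (hg.sub hf) ?_ ?_
    · intro t ht
      rw [interior_Icc] at ht
      exact ((hg' t ht).sub (hf' t ht)).hasDerivWithinAt
    · intro t ht
      rw [interior_Icc] at ht
      exact sub_nonneg.2 (hle t ht)
  have := hmono (left_mem_Icc.2 hxy) (right_mem_Icc.2 hxy) hxy
  simp only at this
  linarith

/-- The primitive of a function continuous on `[s, ∞)`, vanishing at `s`. -/
theorem exists_primitive_Ici {g : ℝ → ℝ} {s : ℝ} (hg : ContinuousOn g (Ici s)) :
    ContinuousOn (fun t => ∫ u in s..t, g u) (Ici s) ∧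
      ∀ t, s < t → HasDerivAt (fun t => ∫ u in s..t, g u) (g t) t := by
  have hcont : Continuous fun t => g (max s t) :=
    hg.comp_continuous (by fun_prop) fun t => le_max_left s t
  have heq : EqOn (fun t => ∫ u in s..t, g u) (fun t => ∫ u in s..t, g (max s u)) (Ici s) := by
    intro t ht
    refine intervalIntegral.integral_congr fun u hu => ?_
    rw [uIcc_of_le ht] at hu
    simp [max_eq_right hu.1]
  have hder : ∀ t, HasDerivAt (fun t => ∫ u in s..t, g (max s u)) (g (max s t)) t := fun t =>
    (hcont.integral_hasStrictDerivAt s t).hasDerivAt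
  refine ⟨ContinuousOn.congr (fun t _ => (hder t).continuousAt.continuousWithinAt) heq, ?_⟩
  intro t ht
  have h := hder t
  rw [max_eq_right ht.le] at h
  exact h.congr_of_eventuallyEq (heq.eventuallyEq_of_mem (Ici_mem_nhds ht))

/-- Solutions of a linear scalar equation keep their sign. -/
theorem pos_of_hasDerivAt_mul_self {f g : ℝ → ℝ} {s : ℝ} (hg : ContinuousOn g (Ici s))
    (hf : ContinuousOn f (Ici s)) (hf' : ∀ t, s < t → HasDerivAt f (g t * f t) t)
    (h0 : 0 < f s) : ∀ t ∈ Ici s, 0 < f t := by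
  intro t ht
  obtain ⟨hGc, hG⟩ := exists_primitive_Ici hg
  set G : ℝ → ℝ := fun t => ∫ u in s..t, g u with hGdef
  have hsub : Icc s t ⊆ Ici s := Icc_subset_Ici_self
  have hfx : ContinuousOn (fun u => f u * rexp (-G u)) (Icc s t) :=
    (hf.mono hsub).mul (hGc.mono hsub).neg.rexp
  have key := sub_le_sub_of_hasDerivAt_le (f := fun _ => (0 : ℝ)) (f' := fun _ => 0)
    (g := fun u => f u * rexp (-G u)) (g' := fun _ => 0) ht continuousOn_const hfx
    (fun u _ => hasDerivAt_const u 0)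
    (fun u hu => by
      refine ((hf' u hu.1).mul (hG u hu.1).neg.exp).congr_deriv ?_
      ring) (fun _ _ => le_rfl)
  have hGs : G s = 0 := by simp [hGdef]
  simp only [hGs, neg_zero, Real.exp_zero, mul_one, sub_self] at key
  have : 0 < f t * rexp (-G t) := by linarith
  exact pos_of_mul_pos_left this (Real.exp_pos _).le

/-- Upper bound for the weighted integral along a reflected trajectory of the system
`C' = ε β C (C - μ) h(εP)`, `P' = C - λ`, where `h` is dominated by the derivative of `a`. -/
theorem reflected_integral_le {a a' h C P : ℝ → ℝ} {lam mu beta eps s T r c : ℝ}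
    (hlam : lam < 1) (hmu : 1 < mu) (hbeta : 0 < beta) (hbeta1 : beta ≤ 1)
    (heps : 0 < eps) (hc : 0 ≤ c) (ha : ∀ x, HasDerivAt a (a' x) x) (hmono : StrictMono a)
    (ha1 : ∀ x, 1 < a x) (hh : Continuous h) (hhpos : ∀ x, 0 < h x) (hha : ∀ x, h x ≤ a' x)
    (hr : 2 * mu / (1 - lam) * (a r - 1) < (1 - lam) / 2)
    (hcr : ∀ x, r ≤ x → c ≤ ∫ u in (eps * P s)..x, h u ^ 2)
    (hC : ContinuousOn C (Ici s)) (hP : ContinuousOn P (Ici s))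
    (hC' : ∀ t, s < t → HasDerivAt C (eps * (beta * C t * (C t - mu) * h (eps * P t))) t)
    (hP' : ∀ t, s < t → HasDerivAt P (C t - lam) t)
    (hCs : C s = 1) (hsT : s < T) (hPT : P T = P s) :
    eps * ∫ t in s..T, (C t - lam) / √(C t) * h (eps * P t) ^ 2 ≤ -(c * (1 - lam) / 4) := by
  have hhP : ContinuousOn (fun t => h (eps * P t)) (Ici s) :=
    hh.comp_continuousOn (continuousOn_const.mul hP)
  have hCpos : ∀ t ∈ Ici s, 0 < C t := by
    refine pos_of_hasDerivAt_mul_self (g := fun t => eps * (beta * (C t - mu) * h (eps * P t)))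
      (by fun_prop) hC (fun t ht => ?_) (by rw [hCs]; norm_num)
    refine (hC' t ht).congr_deriv ?_
    ring
  have hCmu : ∀ t ∈ Ici s, 0 < mu - C t := by
    refine pos_of_hasDerivAt_mul_self (g := fun t => eps * (beta * C t * h (eps * P t)))
      (by fun_prop) (continuousOn_const.sub hC) (fun t ht => ?_) (by rw [hCs]; linarith)
    refine ((hC' t ht).const_sub mu).congr_deriv ?_
    ring
  have hC'neg : ∀ t, s < t → eps * (beta * C t * (C t - mu) * h (eps * P t)) ≤ 0 := by
    intro t ht
    have h1 := hCpos t ht.le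
    have h2 := hCmu t ht.le
    have h3 := hhpos (eps * P t)
    have : 0 < eps * (beta * C t * (mu - C t) * h (eps * P t)) := by positivity
    linarith
  have hsub : ∀ {x y : ℝ}, s ≤ x → Icc x y ⊆ Ici s := fun hx t ht => hx.trans ht.1
  have hanti : ∀ x y, s ≤ x → x ≤ y → C y ≤ C x := by
    intro x y hx hxy
    have := sub_le_sub_of_hasDerivAt_le (g := fun _ => (0 : ℝ)) (g' := fun _ => 0) hxy
      (hC.mono (hsub hx)) continuousOn_const (fun t ht => hC' t (hx.trans_lt ht.1))
      (fun t _ => hasDerivAt_const t 0) (fun t ht => hC'neg t (hx.trans_lt ht.1))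
    simp only [sub_self] at this
    linarith
  -- the turning point
  obtain ⟨t₂, ht₂, hCt₂⟩ : ∃ t ∈ Ioo s T, C t = lam := by
    obtain ⟨t, ht, h0⟩ := exists_hasDerivAt_eq_zero hsT (hP.mono (hsub le_rfl)) hPT.symm
      (fun t ht => hP' t ht.1)
    exact ⟨t, ht, by linarith⟩
  obtain ⟨t₁, ht₁, hCt₁⟩ : ∃ t ∈ Icc s t₂, C t = (1 + lam) / 2 := by
    have := intermediate_value_Icc' ht₂.1.le (hC.mono (hsub le_rfl))
    rw [hCs, hCt₂] at this
    exact this ⟨by linarith, by linarith⟩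
  have hPup : ∀ x y, s ≤ x → x ≤ y → y ≤ t₂ → P x ≤ P y := by
    intro x y hx hxy hy
    have := sub_le_sub_of_hasDerivAt_le (f := fun _ => (0 : ℝ)) (f' := fun _ => 0) hxy
      continuousOn_const (hP.mono (hsub hx)) (fun t _ => hasDerivAt_const t 0)
      (fun t ht => hP' t (hx.trans_lt ht.1)) (fun t ht => by
        have := hanti t t₂ (hx.trans ht.1.le) (ht.2.le.trans hy)
        linarith)
    simp only [sub_self] at this
    linarith
  have hPdown : ∀ x, t₂ ≤ x → x ≤ T → P s ≤ P x := by
    intro x hx hxT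
    have hsx : s ≤ x := ht₂.1.le.trans hx
    have := sub_le_sub_of_hasDerivAt_le (g := fun _ => (0 : ℝ)) (g' := fun _ => 0) hxT
      (hP.mono (hsub hsx)) continuousOn_const (fun t ht => hP' t (hsx.trans_lt ht.1))
      (fun t _ => hasDerivAt_const t 0) (fun t ht => by
        have := hanti t₂ t ht₂.1.le (hx.trans ht.1.le)
        linarith)
    simp only [sub_self] at this
    linarith
  have hPge : ∀ x, s ≤ x → x ≤ T → P s ≤ P x := fun x hx hxT =>
    (le_total x t₂).elim (hPup s x le_rfl hx) (fun hx' => hPdown x hx' hxT)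
  -- the position reached before the velocity drops
  have hpos : r ≤ eps * P t₁ := by
    have hac : Continuous a := continuous_iff_continuousAt.2 fun x => (ha x).continuousAt
    have key := sub_le_sub_of_hasDerivAt_le (f := fun t => -C t)
      (g := fun t => 2 * mu / (1 - lam) * a (eps * P t)) ht₁.1 (hC.mono (hsub le_rfl)).neg
      (continuousOn_const.mul (hac.comp_continuousOn
        (continuousOn_const.mul (hP.mono (hsub le_rfl)))))
      (fun t ht => (hC' t ht.1).neg)
      (fun t ht => ((ha (eps * P t)).comp t ((hP' t ht.1).const_mul eps)).const_mul _)
      (fun t ht => by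
        have h1 := hCpos t ht.1.le
        have h2 := hCmu t ht.1.le
        have h3 := hhpos (eps * P t)
        have h4 := hha (eps * P t)
        have h5 : C t ≤ 1 := hCs ▸ hanti s t le_rfl ht.1.le
        have h6 : (1 + lam) / 2 ≤ C t := hCt₁ ▸ hanti t t₁ ht.1.le ht.2.le
        have h7 : beta * C t * (mu - C t) ≤ 1 * 1 * mu := by gcongr; linarith
        have h8 : beta * C t * (mu - C t) * h (eps * P t) ≤ mu * a' (eps * P t) :=
          mul_le_mul (by linarith) h4 h3.le (by linarith)
        have h9 : 0 < 1 - lam := by linarith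
        have h10 : (1 : ℝ) ≤ 2 * (C t - lam) / (1 - lam) := by
          rw [le_div_iff₀ h9]; linarith
        have h11 : 0 < mu * a' (eps * P t) := mul_pos (by linarith) (h3.trans_le h4)
        calc -(eps * (beta * C t * (C t - mu) * h (eps * P t)))
            = eps * (beta * C t * (mu - C t) * h (eps * P t)) := by ring
          _ ≤ eps * (mu * a' (eps * P t) * 1) := by rw [mul_one]; gcongr
          _ ≤ eps * (mu * a' (eps * P t) * (2 * (C t - lam) / (1 - lam))) := by gcongr
          _ = _ := by field_simp)
    have hK : 0 < 2 * mu / (1 - lam) := div_pos (by linarith) (by linarith)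
    have h1 := ha1 (eps * P s)
    by_contra! hlt
    have h2 := hmono hlt
    have h3 : 2 * mu / (1 - lam) * (a (eps * P t₁) - a (eps * P s)) ≤
      2 * mu / (1 - lam) * (a r - 1) := mul_le_mul_of_nonneg_left (by linarith) hK.le
    rw [hCs, hCt₁] at key
    linarith
  -- integration by parts in differential form
  set H : ℝ → ℝ := fun x => ∫ u in (eps * P s)..x, h u ^ 2 with hHdef
  have hH' : ∀ x, HasDerivAt H (h x ^ 2) x := fun x =>
    ((hh.pow 2).integral_hasStrictDerivAt _ x).hasDerivAt
  have hHnonneg : ∀ t, s ≤ t → t ≤ T → 0 ≤ H (eps * P t) := fun t hst htT =>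
    intervalIntegral.integral_nonneg
      (mul_le_mul_of_nonneg_left (hPge t hst htT) heps.le) fun u _ => sq_nonneg _
  have hHc : Continuous H := continuous_iff_continuousAt.2 fun x => (hH' x).continuousAt
  have hsqrt : ContinuousOn (fun t => √(C t)) (Ici s) := hC.sqrt
  have hsqrtne : ∀ t ∈ Ici s, √(C t) ≠ 0 := fun t ht => (Real.sqrt_pos.2 (hCpos t ht)).ne'
  have hint : ContinuousOn (fun t => (C t - lam) / √(C t) * h (eps * P t) ^ 2) (Ici s) :=
    ((hC.sub continuousOn_const).div hsqrt hsqrtne).mul (hhP.pow 2)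
  obtain ⟨hIc, hI'⟩ := exists_primitive_Ici hint
  set I : ℝ → ℝ := fun t => ∫ u in s..t, (C u - lam) / √(C u) * h (eps * P u) ^ 2 with hIdef
  have hJc : ContinuousOn (fun t => eps * I t - H (eps * P t) / √(C t)) (Ici s) :=
    (continuousOn_const.mul hIc).sub
      ((hHc.comp_continuousOn (continuousOn_const.mul hP)).div hsqrt hsqrtne)
  have hJ' : ∀ t, s < t → HasDerivAt (fun t => eps * I t - H (eps * P t) / √(C t))
      (H (eps * P t) * (eps * (beta * C t * (C t - mu) * h (eps * P t))) /
        (2 * √(C t) * C t)) t := by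
    intro t ht
    have hCt := hCpos t ht.le
    have hq := Real.sqrt_pos.2 hCt
    have h1 := ((hH' (eps * P t)).comp t ((hP' t ht).const_mul eps)).div
      ((hC' t ht).sqrt hCt.ne') hq.ne'
    have h2 := ((hI' t ht).const_mul eps).sub h1
    refine h2.congr_deriv ?_
    have hsq : C t = √(C t) ^ 2 := (Real.sq_sqrt hCt.le).symm
    generalize eps * (beta * C t * (C t - mu) * h (eps * P t)) = D
    rw [Function.comp_apply]
    generalize H (eps * P t) = H0
    rw [← hsq]
    field_simp
    rw [show √(C t) ^ 2 = C t from hsq.symm]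
    ring
  have hJle : ∀ x y, s ≤ x → x ≤ y → y ≤ T →
      (eps * I y - H (eps * P y) / √(C y)) - (eps * I x - H (eps * P x) / √(C x)) ≤ 0 := by
    intro x y hx hxy hy
    have := sub_le_sub_of_hasDerivAt_le (g := fun _ => (0 : ℝ)) (g' := fun _ => 0) hxy
      (hJc.mono (hsub hx)) continuousOn_const (fun t ht => hJ' t (hx.trans_lt ht.1))
      (fun t _ => hasDerivAt_const t 0) (fun t ht => by
        have hst := hx.trans_lt ht.1
        have h1 := hCpos t hst.le
        exact div_nonpos_of_nonpos_of_nonneg (mul_nonpos_of_nonneg_of_nonpos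
          (hHnonneg t hst.le (ht.2.le.trans hy)) (hC'neg t hst)) (by positivity))
    simpa using this
  have hJdrop := sub_le_sub_of_hasDerivAt_le ht₁.2 (hJc.mono (hsub ht₁.1))
    (g := fun t => c / 2 * C t) (continuousOn_const.mul (hC.mono (hsub ht₁.1)))
    (fun t ht => hJ' t (ht₁.1.trans_lt ht.1))
    (fun t ht => (hC' t (ht₁.1.trans_lt ht.1)).const_mul (c / 2)) (fun t ht => by
      have hst := ht₁.1.trans_lt ht.1
      have h1 := hCpos t hst.le
      have h2 : C t ≤ 1 := hCs ▸ hanti s t le_rfl hst.le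
      have h3 := hC'neg t hst
      have h4 : c ≤ H (eps * P t) := hcr _ (hpos.trans
        (mul_le_mul_of_nonneg_left (hPup t₁ t ht₁.1 ht.1.le ht.2.le) heps.le))
      have h5 : √(C t) ≤ 1 := Real.sqrt_le_one.2 h2
      have h6 := Real.sqrt_pos.2 h1
      have h7 : √(C t) * C t ≤ 1 := mul_le_one₀ h5 h1.le h2
      generalize eps * (beta * C t * (C t - mu) * h (eps * P t)) = D at h3 ⊢
      rw [div_le_iff₀ (by positivity)]
      have h8 : c * (√(C t) * C t) ≤ H (eps * P t) :=
        (mul_le_of_le_one_right hc h7).trans h4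
      have h9 := mul_le_mul_of_nonpos_right h8 h3
      linarith)
  have hs1 := hJle s t₁ le_rfl ht₁.1 (ht₁.2.trans ht₂.2.le)
  have hs2 := hJle t₂ T ht₂.1.le ht₂.2.le le_rfl
  have hHs : H (eps * P s) = 0 := by simp [hHdef]
  have hIs : I s = 0 := by simp [hIdef]
  rw [hHs, hIs] at hs1
  rw [hPT, hHs] at hs2
  simp only [hCt₁, hCt₂] at hJdrop hs1 hs2
  simp only [zero_div, mul_zero, sub_zero] at hs1 hs2
  linarith

/-- If `a ≤ 1 + K e^{γ r}` on the negative half-line, then `a` gets arbitrarily close to `1`. -/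
theorem exists_sub_one_lt {a : ℝ → ℝ} {K gam d : ℝ} (hgam : 0 < gam)
    (ha : ∀ r : ℝ, r ≤ 0 → a r - 1 ≤ K * rexp (gam * r)) (hd : 0 < d) :
    ∃ r, a r - 1 < d := by
  have hlim : Tendsto (fun r => K * rexp (gam * r)) atBot (nhds (K * 0)) :=
    (Real.tendsto_exp_atBot.comp (tendsto_id.const_mul_atBot hgam)).const_mul K
  rw [mul_zero] at hlim
  obtain ⟨r, hr, hr0⟩ := ((hlim.eventually_lt_const hd).and (eventually_le_atBot 0)).exists
  exact ⟨r, (ha r hr0).trans_lt hr⟩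

/-- for `λ̃ < λ < 1`, the key integral
`ε ∫_{-T_ε}^{T̃_ε} ((C-λ)/√C) (a'(εP)/a(εP))² dt` is bounded above by a strictly
negative constant `-κ`, uniformly in `ε` small. -/
theorem statement19 (m : ℕ) (hm : m = 2 ∨ m = 3 ∨ m = 4)
    (a : ℝ → ℝ) (ha : Admissible a)
    (tl : ℝ) (htl0 : lam0 m < tl) (htl1 : tl < 1)
    (htl : tl * ((1 - lam0 m) / (tl - lam0 m)) ^ (1 - lam0 m)
      = (2 : ℝ) ^ ((4 : ℝ) / ((m : ℝ) + 3)))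
    (lam : ℝ) (hlam0 : tl < lam) (hlam1 : lam < 1) :
    ∃ κ ε₀ : ℝ, 0 < κ ∧ 0 < ε₀ ∧ ∀ eps : ℝ, 0 < eps → eps < ε₀ →
      ∀ C P : ℝ → ℝ, IsSolODE m lam a eps C P →
        ∀ Tt : ℝ, -Teps lam eps < Tt → P Tt = -((1 - lam) * Teps lam eps) →
          eps * ∫ t in (-Teps lam eps)..Tt,
              ((C t - lam) / C t ^ ((1 : ℝ) / 2))
                * (deriv a (eps * P t) ^ 2 / a (eps * P t) ^ 2)
            ≤ -κ := by
  obtain ⟨hdiff, K, gam, -, hgam, hbd, hleft, -, -⟩ := ha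
  have hm2 : (2 : ℝ) ≤ m ∧ (m : ℝ) ≤ 4 := by rcases hm with rfl | rfl | rfl <;> norm_num
  have hm3 : (0 : ℝ) < (m : ℝ) + 3 := by linarith
  have hl0 : 0 < lam0 m := div_pos (by linarith) hm3
  have hl1 : lam0 m < lam := htl0.trans hlam0
  have hmu : 1 < lam / lam0 m := (one_lt_div hl0).2 hl1
  have hmupos : 0 < lam / lam0 m := by linarith
  have hder : ∀ x, HasDerivAt a (deriv a x) x := fun x =>
    (hdiff.differentiable (by norm_num) x).hasDerivAt
  have hmono : StrictMono a := strictMono_of_deriv_pos fun x => (hbd x).2.2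
  have hapos : ∀ x, 0 < a x := fun x => one_pos.trans (hbd x).1
  have hh : Continuous fun x => deriv a x / a x :=
    (hdiff.continuous_deriv (by norm_num)).div hdiff.continuous fun x => (hapos x).ne'
  have hhpos : ∀ x, 0 < deriv a x / a x := fun x => div_pos (hbd x).2.2 (hapos x)
  have h1l : 0 < 1 - lam := by linarith
  obtain ⟨r, hr⟩ := exists_sub_one_lt hgam hleft
    (d := (1 - lam) / 2 / (2 * (lam / lam0 m) / (1 - lam))) (by positivity)
  rw [lt_div_iff₀ (by positivity), mul_comm] at hr
  set c : ℝ := ∫ u in (r - 1)..r, (deriv a u / a u) ^ 2 with hcdef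
  have hc : 0 < c := intervalIntegral.intervalIntegral_pos_of_pos
    ((hh.pow 2).intervalIntegrable _ _) (fun x => pow_pos (hhpos x) 2) (by linarith)
  set M : ℝ := 1 + |r| with hM
  have hMpos : 0 < M := by positivity
  refine ⟨c * (1 - lam) / 4, M ^ (-100 : ℝ), by positivity, by positivity, ?_⟩
  intro eps heps heps0 C P hsol Tt hTt hPT
  obtain ⟨hode, hCs, hPs⟩ := hsol
  have hstart : eps * P (-Teps lam eps) ≤ r - 1 := by
    have h1 : eps * P (-Teps lam eps) = -eps ^ (-(1 : ℝ) / 100) := by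
      have h2 : eps ^ (-(1 : ℝ) / 100) = eps * eps ^ (-(1 : ℝ) - 1 / 100) := by
        rw [← Real.rpow_one_add' heps.le (by norm_num)]
        norm_num
      rw [hPs, Teps, h2]
      field_simp
    have h3 : M ≤ eps ^ (-(1 : ℝ) / 100) := by
      have h4 := Real.rpow_le_rpow_of_nonpos heps heps0.le
        (show (-(1 : ℝ) / 100) ≤ 0 by norm_num)
      rwa [← Real.rpow_mul hMpos.le, show (-100 : ℝ) * (-(1 : ℝ) / 100) = 1 by norm_num,
        Real.rpow_one] at h4
    rw [h1]
    linarith [neg_abs_le r]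
  have hcr : ∀ x, r ≤ x →
      c ≤ ∫ u in (eps * P (-Teps lam eps))..x, (deriv a u / a u) ^ 2 := fun x hx =>
    intervalIntegral.integral_mono_interval hstart (by linarith) hx
      (Eventually.of_forall fun u => sq_nonneg _) ((hh.pow 2).intervalIntegrable _ _)
  have hmain := reflected_integral_le (beta := 4 / ((m : ℝ) + 3)) (C := C) (P := P)
    hlam1 hmu (by positivity) (by rw [div_le_one hm3]; linarith) heps hc.le
    hder hmono (fun x => (hbd x).1) hh hhpos
    (fun x => div_le_self (hbd x).2.2.le (hbd x).1.le) hr hcr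
    (fun t ht => (hode t ht).1.continuousWithinAt) (fun t ht => (hode t ht).2.continuousWithinAt)
    (fun t ht => by
      refine ((hode t ht.le).1.hasDerivAt (Ici_mem_nhds ht)).congr_deriv ?_
      rw [f1]
      ring)
    (fun t ht => (hode t ht.le).2.hasDerivAt (Ici_mem_nhds ht))
    hCs hTt (hPT.trans hPs.symm)
  simpa only [Real.sqrt_eq_rpow, div_pow] using hmain
end
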